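/- The alternating group Alt(6) (the alternating group on 6 points) has exactly 1440 proper skew morphisms; that is, the number of bijections φ : Alt(6) → Alt(6) with φ(1) = 1 that admit a power function π : Alt(6) → ℕ satisfying φ(a·b) = φ(a)·φ^{π(a)}(b) for all a, b, and that are not group homomorphisms, is 1440. -/

import Mathlib

/-- A skew morphism of a group `B`: a bijection fixing `1` admitting a power
function `π` with `φ (a * b) = φ a * φ^[π a] b`. -/
def IsSkewMorphism {B : Type*} [Group B] (φ : B → B) : Prop :=
  Function.Bijective φ ∧ φ 1 = 1 ∧
    ∃ π : B → ℕ, ∀ a b : B, φ (a * b) = φ a * φ^[π a] b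

/-- A proper skew morphism: a skew morphism that is not a group homomorphism. -/
def IsProperSkewMorphism {B : Type*} [Group B] (φ : B → B) : Prop :=
  IsSkewMorphism φ ∧ ¬ (∀ a b : B, φ (a * b) = φ a * φ b)

open Equiv


section Schur
variable {B A : Type*} [Group B] [AddCommGroup A]

theorem sk_sub {ρ : B →* Perm A} {τ : A → B → B}
    (hτ : ∀ b x y, ρ b (x + y) = ρ b x + ρ (τ x b) y) (b : B) (z g : A) :
    ρ b z - ρ b g = ρ (τ g b) (z - g) := by
  have := hτ b g (z - g)
  rw [add_sub_cancel] at this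
  rw [this]; abel

theorem sk_closure_inv [Finite A] {ρ : B →* Perm A} {τ : A → B → B}
    (h0 : ∀ b, ρ b 0 = 0)
    (hτ : ∀ b x y, ρ b (x + y) = ρ b x + ρ (τ x b) y) (S : Set A)
    (hS : ∀ b, ∀ x ∈ S, ρ b x ∈ S) :
    ∀ b, ∀ x ∈ AddSubgroup.closure S, ρ b x ∈ AddSubgroup.closure S := by
  intro b x hx
  have key : ∀ x ∈ AddSubmonoid.closure S, ∀ b, ρ b x ∈ AddSubmonoid.closure S := by
    intro x hx
    induction hx using AddSubmonoid.closure_induction with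
    | mem x hx => exact fun b => AddSubmonoid.subset_closure (hS b x hx)
    | zero => intro b; rw [h0]; exact zero_mem _
    | add x y _ _ hx hy => intro b; rw [hτ]; exact add_mem (hx _) (hy _)
  have e := AddSubgroup.closure_toAddSubmonoid_of_finite (s := S)
  rw [← AddSubgroup.mem_toAddSubmonoid, e] at hx ⊢
  exact key x hx b

theorem conv_inv [Fintype A] {R : Type*} [CommRing R] {ρ : B →* Perm A} {τ : A → B → B}
    (hτ : ∀ b x y, ρ b (x + y) = ρ b x + ρ (τ x b) y)
    (f g : AddMonoidAlgebra R A) (hf : ∀ b x, f.coeff (ρ b x) = f.coeff x)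
    (hg : ∀ b x, g.coeff (ρ b x) = g.coeff x)
    (b : B) (z : A) : (f * g).coeff (ρ b z) = (f * g).coeff z := by
  classical
  have key : ∀ z, (f * g).coeff z = ∑ x, f.coeff x * g.coeff (z - x) := by
    intro z
    have : f = ∑ x, AddMonoidAlgebra.single x (f.coeff x) := by
      ext y
      simp [AddMonoidAlgebra.coeff_sum]
    conv_lhs => rw [this, Finset.sum_mul]
    rw [AddMonoidAlgebra.coeff_sum, Finsupp.finsetSum_apply]
    refine Finset.sum_congr rfl fun x _ => ?_
    rw [AddMonoidAlgebra.coeff_single_mul_apply, neg_add_eq_sub]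
  rw [key, key, ← Equiv.sum_comp (ρ b)]
  refine Finset.sum_congr rfl fun x _ => ?_
  rw [hf, sk_sub hτ, hg]

theorem pow_inv [Fintype A] {R : Type*} [CommRing R] {ρ : B →* Perm A} {τ : A → B → B}
    (h0 : ∀ b, ρ b 0 = 0)
    (hτ : ∀ b x y, ρ b (x + y) = ρ b x + ρ (τ x b) y)
    (f : AddMonoidAlgebra R A) (hf : ∀ b x, f.coeff (ρ b x) = f.coeff x) (k : ℕ)
    (b : B) (z : A) : (f ^ k).coeff (ρ b z) = (f ^ k).coeff z := by
  classical
  induction k generalizing b z with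
  | zero =>
    have : ρ b z = 0 ↔ z = 0 := by
      constructor
      · intro h; rw [← h0 b] at h; exact (ρ b).injective h
      · rintro rfl; exact h0 b
    rw [pow_zero, AddMonoidAlgebra.one_def, AddMonoidAlgebra.coeff_single, Finsupp.single_apply,
      Finsupp.single_apply, eq_comm (a := 0), eq_comm (a := 0)]
    simp only [this]
  | succ k ih => rw [pow_succ]; exact conv_inv hτ _ _ ih hf b z

/-- For a `B`-invariant set `S`, the number of `x ∈ S` with `p x = y` modulo `p` is invariant. -/
theorem frob_inv [Fintype A] [DecidableEq A] {ρ : B →* Perm A} {τ : A → B → B}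
    (h0 : ∀ b, ρ b 0 = 0)
    (hτ : ∀ b x y, ρ b (x + y) = ρ b x + ρ (τ x b) y) (S : Finset A)
    (hS : ∀ b x, ρ b x ∈ S ↔ x ∈ S) (p : ℕ) [Fact p.Prime] (b : B) (z : A) :
    (((S.filter fun x => p • x = ρ b z).card : ℕ) : ZMod p)
      = ((S.filter fun x => p • x = z).card : ℕ) := by
  classical
  let f : AddMonoidAlgebra (ZMod p) A := ∑ x ∈ S, AddMonoidAlgebra.single x 1
  have hf : ∀ x, f.coeff x = if x ∈ S then 1 else 0 := by
    intro x
    simp [f, AddMonoidAlgebra.coeff_sum, Finsupp.finsetSum_apply, Finsupp.single_apply]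
  have : CharP (AddMonoidAlgebra (ZMod p) A) p :=
    charP_of_injective_algebraMap (algebraMap (ZMod p) (AddMonoidAlgebra (ZMod p) A)).injective p
  have hp : f ^ p = ∑ x ∈ S, AddMonoidAlgebra.single (p • x) 1 := by
    rw [sum_pow_char]
    refine Finset.sum_congr rfl fun x _ => ?_
    rw [AddMonoidAlgebra.single_pow, one_pow]
  have hc : ∀ z, (f ^ p).coeff z = ((S.filter fun x => p • x = z).card : ℕ) := by
    intro z
    rw [hp]
    simp [AddMonoidAlgebra.coeff_sum, Finsupp.finsetSum_apply, Finsupp.single_apply]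
  rw [← hc, ← hc]
  refine pow_inv h0 hτ f ?_ p b z
  intro b x
  rw [hf, hf]; simp [hS]

theorem schur_aux [Fintype A] [DecidableEq A] [IsAddCyclic A] {ρ : B →* Perm A} {τ : A → B → B}
    (h0 : ∀ b, ρ b 0 = 0)
    (hτ : ∀ b x y, ρ b (x + y) = ρ b x + ρ (τ x b) y)
    (hprim : ∀ D : AddSubgroup A, (∀ b, ∀ x ∈ D, ρ b x ∈ D) → D = ⊥ ∨ D = ⊤)
    (p : ℕ) (hp : p.Prime) (hpA : p ∣ Fintype.card A) (hne : Fintype.card A ≠ p)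
    (S : Finset A) (hS : ∀ b x, ρ b x ∈ S ↔ x ∈ S) (hS0 : 0 ∉ S) (hSn : S.Nonempty)
    : (∀ x ∈ S, p • x ≠ 0 → ∀ u, p • u = 0 → x - u ∈ S) ∧ ∃ x ∈ S, p • x = 0 := by
  classical
  have : Fact p.Prime := ⟨hp⟩
  have hPle : (Finset.univ.filter fun x : A => p • x = 0).card ≤ p :=
    IsAddCyclic.card_nsmul_eq_zero_le hp.pos
  have hPpos : ∃ u : A, u ≠ 0 ∧ p • u = 0 := by
    obtain ⟨u, hu⟩ := exists_prime_addOrderOf_dvd_card p hpA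
    refine ⟨u, ?_, ?_⟩
    · rintro rfl
      rw [addOrderOf_zero] at hu
      exact hp.one_lt.ne hu
    · rw [← hu]; exact addOrderOf_nsmul_eq_zero u
  have hmul : ∃ x : A, ∀ y, p • y ≠ x := by
    by_contra! h
    have hinj : Function.Injective fun y : A => p • y :=
      Finite.injective_iff_surjective.2 h
    obtain ⟨u, hu0, hu⟩ := hPpos
    exact hu0 (hinj (by simpa using hu))
  -- fibres
  have hA : ∀ y, y ≠ 0 → p ∣ (S.filter fun x => p • x = y).card := by
    intro y hy
    by_contra hdiv
    let V : Set A := {z | ¬ p ∣ (S.filter fun x => p • x = z).card}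
    have hV : ∀ b, ∀ z ∈ V, ρ b z ∈ V := by
      intro b z hz hz'
      apply hz
      have := frob_inv h0 hτ S hS p b z
      rw [(ZMod.natCast_eq_zero_iff _ _).2 hz'] at this
      exact (ZMod.natCast_eq_zero_iff _ _).1 this.symm
    have hcl := sk_closure_inv h0 hτ V hV
    rcases hprim _ hcl with h | h
    · rw [AddSubgroup.closure_eq_bot_iff] at h
      exact hy (h hdiv)
    · obtain ⟨x, hx⟩ := hmul
      have hsub : V ⊆ (nsmulAddMonoidHom (α := A) p).range := by
        intro z hz
        have : (S.filter fun x => p • x = z).Nonempty := by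
          rw [Finset.nonempty_iff_ne_empty]
          intro he
          apply hz
          rw [he]; simp
        obtain ⟨w, hw⟩ := this
        exact ⟨w, (Finset.mem_filter.1 hw).2⟩
      have : x ∈ (nsmulAddMonoidHom (α := A) p).range := by
        apply (AddSubgroup.closure_le _).2 hsub
        rw [h]; trivial
      obtain ⟨w, hw⟩ := this
      exact hx w hw
  have hB : ∀ x ∈ S, p • x ≠ 0 → ∀ u, p • u = 0 → x - u ∈ S := by
    intro x hx hpx u hu
    have hd := hA _ hpx
    have hpos : 0 < (S.filter fun z => p • z = p • x).card :=
      Finset.card_pos.2 ⟨x, by simp [hx]⟩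
    have hle := Nat.le_of_dvd hpos hd
    have him : (S.filter fun z => p • z = p • x) =
        (Finset.univ.filter fun x : A => p • x = 0).image (fun u => x - u) := by
      apply Finset.eq_of_subset_of_card_le
      · intro z hz
        simp only [Finset.mem_filter] at hz
        simp only [Finset.mem_image, Finset.mem_filter, Finset.mem_univ, true_and]
        exact ⟨x - z, by rw [nsmul_sub, hz.2, sub_self], by abel⟩
      · refine Finset.card_image_le.trans ?_
        omega
    have : x - u ∈ (S.filter fun z => p • z = p • x) := by
      rw [him]
      simp only [Finset.mem_image, Finset.mem_filter, Finset.mem_univ, true_and]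
      exact ⟨u, hu, rfl⟩
    exact (Finset.mem_filter.1 this).1
  refine ⟨hB, ?_⟩
  by_contra! hno
  let R : AddSubgroup A :=
    { carrier := {g | ∀ z, z ∈ S ↔ z - g ∈ S}
      zero_mem' := by intro z; simp
      add_mem' := by
        intro a b ha hb z
        rw [ha z, hb (z - a), sub_sub]
      neg_mem' := by
        intro a ha z
        rw [ha (z - -a)]; simp }
  have hR : ∀ b, ∀ x ∈ R, ρ b x ∈ R := by
    intro b g hg z
    obtain ⟨w, rfl⟩ := (ρ b).surjective z
    rw [sk_sub hτ, hS, hS]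
    exact hg w
  obtain ⟨u, hu0, hu⟩ := hPpos
  have huR : u ∈ R := by
    intro z
    constructor
    · intro hz; exact hB z hz (hno z hz) u hu
    · intro hz
      have := hB _ hz (hno _ hz) (-u) (by simp [hu])
      simpa using this
  rcases hprim R hR with h | h
  · rw [h] at huR; exact hu0 (by simpa using huR)
  · obtain ⟨s, hs⟩ := hSn
    have : s ∈ R := by rw [h]; trivial
    have := (this s).1 hs
    rw [sub_self] at this
    exact hS0 this

theorem schur_small [Fintype A] [DecidableEq A] [IsAddCyclic A] {ρ : B →* Perm A} {τ : A → B → B}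
    (h0 : ∀ b, ρ b 0 = 0)
    (hτ : ∀ b x y, ρ b (x + y) = ρ b x + ρ (τ x b) y)
    (hprim : ∀ D : AddSubgroup A, (∀ b, ∀ x ∈ D, ρ b x ∈ D) → D = ⊥ ∨ D = ⊤)
    (p : ℕ) (hp : p.Prime) (hpA : p ∣ Fintype.card A) (hne : Fintype.card A ≠ p)
    (S : Finset A) (hS : ∀ b x, ρ b x ∈ S ↔ x ∈ S) (hS0 : 0 ∉ S) (hSn : S.Nonempty)
    (hsmall : 2 * S.card ≤ Fintype.card A - 1) : False := by
  classical
  have hPle : (Finset.univ.filter fun x : A => p • x = 0).card ≤ p :=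
    IsAddCyclic.card_nsmul_eq_zero_le hp.pos
  have hB := (schur_aux h0 hτ hprim p hp hpA hne S hS hS0 hSn).1
  have hρ0 : ∀ b x, ρ b x = 0 ↔ x = 0 := by
    intro b x
    constructor
    · intro h; rw [← h0 b] at h; exact (ρ b).injective h
    · rintro rfl; exact h0 b
  -- every nonzero orbit meets the socle
  have hmeet : ∀ g : A, g ≠ 0 → ∃ b, p • (ρ b g) = 0 := by
    intro g hg
    let O : Finset A := Finset.univ.filter fun x => ∃ b, ρ b g = x
    have hO : ∀ b x, ρ b x ∈ O ↔ x ∈ O := by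
      intro b x
      simp only [O, Finset.mem_filter, Finset.mem_univ, true_and]
      constructor
      · rintro ⟨c, hc⟩
        refine ⟨b⁻¹ * c, ?_⟩
        rw [map_mul, Perm.mul_apply, hc, map_inv]; simp
      · rintro ⟨c, rfl⟩
        exact ⟨b * c, by rw [map_mul, Perm.mul_apply]⟩
    have hO0 : 0 ∉ O := by
      simp only [O, Finset.mem_filter, Finset.mem_univ, true_and, not_exists]
      intro b hb
      exact hg ((hρ0 b g).1 hb)
    have hOn : O.Nonempty := ⟨g, by simp only [O, Finset.mem_filter, Finset.mem_univ, true_and]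
                                    exact ⟨1, by simp⟩⟩
    obtain ⟨x, hx, hpx⟩ := (schur_aux h0 hτ hprim p hp hpA hne O hO hO0 hOn).2
    simp only [O, Finset.mem_filter, Finset.mem_univ, true_and] at hx
    obtain ⟨b, rfl⟩ := hx
    exact ⟨b, hpx⟩
  let lam : A → ℕ := fun g => (S.filter fun z => z - g ∈ S).card
  have hlam : ∀ b g, lam (ρ b g) = lam g := by
    intro b g
    symm
    refine Finset.card_bij (fun z _ => ρ b z) ?_ ?_ ?_
    · intro z hz
      simp only [Finset.mem_filter] at hz ⊢
      rw [sk_sub hτ, hS, hS]; exact hz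
    · intro z _ w _ h; exact (ρ b).injective h
    · intro z hz
      obtain ⟨w, rfl⟩ := (ρ b).surjective z
      simp only [Finset.mem_filter] at hz
      rw [sk_sub hτ, hS, hS] at hz
      exact ⟨w, Finset.mem_filter.2 hz, rfl⟩
  let S1 := S.filter fun x => p • x ≠ 0
  let S0 := S.filter fun x => p • x = 0
  have hS01 : S0.card + S1.card = S.card := by
    exact Finset.card_filter_add_card_filter_not _
  have hlamge : ∀ g, g ≠ 0 → S1.card ≤ lam g := by
    intro g hg
    obtain ⟨b, hb⟩ := hmeet g hg
    rw [← hlam b g]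
    apply Finset.card_le_card
    intro z hz
    simp only [S1, Finset.mem_filter] at hz ⊢
    exact ⟨hz.1, hB z hz.1 hz.2 _ hb⟩
  have hsum : ∑ g, lam g = S.card * S.card := by
    simp only [lam, Finset.card_filter]
    rw [Finset.sum_comm]
    have : ∀ z, (∑ g : A, if z - g ∈ S then 1 else 0) = S.card := by
      intro z
      rw [Fintype.sum_equiv (Equiv.subLeft z) _ (fun y => if y ∈ S then 1 else 0)
        (fun g => by simp)]
      simp
    simp [this]
  have hlam0 : lam 0 = S.card := by
    simp only [lam, sub_zero]
    congr 1
    simp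
  have hge : (Fintype.card A - 1) * S1.card + S.card ≤ S.card * S.card := by
    rw [← hsum, ← Finset.sum_erase_add _ _ (Finset.mem_univ (0 : A)), hlam0]
    have : (Finset.univ.erase (0 : A)).card = Fintype.card A - 1 := by
      rw [Finset.card_erase_of_mem (Finset.mem_univ _), Finset.card_univ]
    rw [← this, ← smul_eq_mul]
    gcongr
    apply Finset.card_nsmul_le_sum
    intro g hg
    exact hlamge g (Finset.ne_of_mem_erase hg)
  have hS0lt : S0.card < p := by
    have : S0.card < (Finset.univ.filter fun x : A => p • x = 0).card := by
      apply Finset.card_lt_card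
      rw [Finset.ssubset_iff_of_subset]
      · refine ⟨0, by simp, ?_⟩
        simp [S0, hS0]
      · intro x hx
        simp only [S0, Finset.mem_filter] at hx
        simp [hx.2]
    omega
  have hS1 : S1 = ∅ := by
    by_contra hne1
    obtain ⟨x, hx⟩ := Finset.nonempty_iff_ne_empty.2 hne1
    have hp1 : p ≤ S1.card := by
      obtain ⟨u, hu⟩ := (by have := Fact.mk hp; exact exists_prime_addOrderOf_dvd_card p hpA :
        ∃ u : A, addOrderOf u = p)
      have hinj : Set.InjOn (fun i : ℕ => x - i • u) (Finset.range p) := by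
        intro i hi j hj hij
        simp only [Finset.coe_range, Set.mem_Iio] at hi hj
        have : i • u = j • u := by simpa using hij
        exact nsmul_injOn_Iio_addOrderOf (by simpa [hu] using hi) (by simpa [hu] using hj) this
      rw [← Finset.card_range p, ← Finset.card_image_of_injOn hinj]
      apply Finset.card_le_card
      intro y hy
      obtain ⟨i, _, rfl⟩ := Finset.mem_image.1 hy
      have hpu : p • (i • u) = 0 := by
        rw [← mul_nsmul', mul_comm, mul_nsmul', ← hu, addOrderOf_nsmul_eq_zero, nsmul_zero]
      simp only [S1, Finset.mem_filter] at hx ⊢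
      refine ⟨hB x hx.1 hx.2 _ hpu, ?_⟩
      rw [nsmul_sub, hpu, sub_zero]; exact hx.2
    nlinarith
  have hSP : ∀ x ∈ S, p • x = 0 := by
    intro x hx
    by_contra h
    have : x ∈ S1 := by simp [S1, hx, h]
    rw [hS1] at this; simp at this
  have hcl := sk_closure_inv h0 hτ (S : Set A) (fun b x hx => (hS b x).2 hx)
  obtain ⟨s, hs⟩ := hSn
  rcases hprim _ hcl with h | h
  · rw [AddSubgroup.closure_eq_bot_iff] at h
    have : s = 0 := h hs
    exact hS0 (this ▸ hs)
  · have hall : ∀ x : A, p • x = 0 := by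
      intro x
      have hx : x ∈ AddSubgroup.closure (S : Set A) := by rw [h]; trivial
      have hle : AddSubgroup.closure (S : Set A) ≤ (nsmulAddMonoidHom (α := A) p).ker :=
        (AddSubgroup.closure_le _).2 (fun x hx => hSP x hx)
      exact hle hx
    have : Fintype.card A ≤ p := by
      rw [← Finset.card_univ]
      refine le_trans (le_of_eq ?_) hPle
      congr 1; ext x; simp [hall]
    have h2 := Nat.le_of_dvd Fintype.card_pos hpA
    omega

end Schur


section Burnside
open Polynomial

theorem taylor_key {p : ℕ} [Fact p.Prime] (S : Finset (ZMod p)) (r : ℕ)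
    (hr1 : 1 ≤ r) (hr : ∑ u ∈ S, u ^ r ≠ 0) (hrm : ∀ j, 1 ≤ j → j < r → ∑ u ∈ S, u ^ j = 0)
    (Q : (ZMod p)[X]) (hD : Q.natDegree < p) (hrD : r ≤ Q.natDegree) (c : ZMod p)
    (hc : c = 0 ∨ r < Q.natDegree)
    (hQ : ∀ x, ∑ u ∈ S, Q.eval (x + u) = S.card * Q.eval x + c) : False := by
  set D := Q.natDegree with hDdef
  have hp : p.Prime := Fact.out
  -- polynomial identity
  have hpoly : ∑ u ∈ S, taylor u Q = C (S.card : ZMod p) * Q + C c := by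
    refine Polynomial.eq_of_natDegree_lt_card_of_eval_eq _ _ (f := fun x : ZMod p => x)
      (Function.injective_id) ?_ ?_
    · intro x
      rw [eval_finsetSum]
      simp only [taylor_eval, eval_add, eval_mul, eval_C]
      rw [← hQ x]
    · rw [ZMod.card]
      refine max_lt ?_ ?_
      · refine lt_of_le_of_lt (natDegree_sum_le_of_forall_le (n := D) S _ ?_) hD
        intro u _
        rw [natDegree_taylor]
      · refine lt_of_le_of_lt (natDegree_add_le _ _) (max_lt ?_ (by simp [hp.pos]))
        exact lt_of_le_of_lt (natDegree_C_mul_le _ _) hD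
  have hcoef := congrArg (fun P => P.coeff (D - r)) hpoly
  simp only [finsetSum_coeff, coeff_add, coeff_C_mul, taylor_coeff] at hcoef
  have hcc : (C c).coeff (D - r) = 0 := by
    rcases hc with rfl | h
    · simp
    · rw [coeff_C, if_neg]; omega
  rw [hcc, add_zero] at hcoef
  have hhd : ∀ u : ZMod p, (hasseDeriv (D - r) Q).eval u =
      ∑ i ∈ Finset.range (D + 1), (i.choose (D - r) : ZMod p) * Q.coeff i * u ^ (i - (D - r)) := by
    intro u
    rw [hasseDeriv_apply, sum_over_range' _ _ (D + 1) (by omega)]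
    · rw [eval_finsetSum]
      simp
    · simp
  simp only [hhd] at hcoef
  rw [Finset.sum_comm, Finset.sum_range_succ] at hcoef
  have hlow : ∑ i ∈ Finset.range D, ∑ u ∈ S,
      (i.choose (D - r) : ZMod p) * Q.coeff i * u ^ (i - (D - r)) = S.card * Q.coeff (D - r) := by
    rw [Finset.sum_eq_single (D - r)]
    · simp
    · intro i hi hne
      rw [← Finset.mul_sum]
      rw [Finset.mem_range] at hi
      by_cases hlt : i < D - r
      · rw [Nat.choose_eq_zero_of_lt hlt]; simp
      · rw [hrm _ (by omega) (by omega), mul_zero]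
    · intro h
      exfalso; apply h; rw [Finset.mem_range]; omega
  rw [hlow, ← Finset.mul_sum] at hcoef
  have h1 := add_eq_left.1 hcoef
  rw [show D - (D - r) = r by omega] at h1
  have hch : ((D.choose (D - r) : ℕ) : ZMod p) ≠ 0 := by
    rw [Ne, ZMod.natCast_eq_zero_iff]
    intro hdvd
    have h2 : p ∣ D.factorial := hdvd.trans ⟨_, by
      rw [← mul_assoc, Nat.choose_mul_factorial_mul_factorial (Nat.sub_le D r)]⟩
    exact absurd ((hp.dvd_factorial).1 h2) (by omega)
  have hlc : Q.coeff D ≠ 0 := by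
    rw [hDdef]
    intro h
    have : Q = 0 := leadingCoeff_eq_zero.1 h
    rw [this] at hDdef
    simp at hDdef
    omega
  exact (mul_ne_zero (mul_ne_zero hch hlc) hr) h1

theorem exists_powersum {p : ℕ} [Fact p.Prime] (S : Finset (ZMod p)) (h0 : 0 ∉ S)
    (hne : S.Nonempty) : ∃ r, 1 ≤ r ∧ r ≤ S.card ∧ ∑ u ∈ S, u ^ r ≠ 0 := by
  classical
  by_contra! h
  obtain ⟨u₀, hu⟩ := hne
  let f : (ZMod p)[X] := X * ∏ u ∈ S.erase u₀, (X - C u)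
  have hdeg : f.natDegree ≤ S.card := by
    refine natDegree_mul_le.trans ?_
    have := natDegree_prod_le (S.erase u₀) (fun u => (X - C u : (ZMod p)[X]))
    simp only [natDegree_X_sub_C, Finset.sum_const, smul_eq_mul, mul_one,
      Finset.card_erase_of_mem hu] at this
    have h1 := Finset.card_pos.2 ⟨u₀, hu⟩
    simp only [natDegree_X]
    omega
  have hsum : ∑ u ∈ S, f.eval u = 0 := by
    have : ∀ u, f.eval u = ∑ i ∈ Finset.range (S.card + 1), f.coeff i * u ^ i := fun u =>
      eval_eq_sum_range' (by omega) u
    simp only [this]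
    rw [Finset.sum_comm]
    apply Finset.sum_eq_zero
    intro i hi
    rw [← Finset.mul_sum]
    rw [Finset.mem_range] at hi
    rcases Nat.eq_zero_or_pos i with rfl | hpos
    · simp [f]
    · rw [h i hpos (by omega), mul_zero]
  rw [Finset.sum_eq_single u₀] at hsum
  · simp only [f, eval_mul, eval_X, eval_prod, eval_sub, eval_C] at hsum
    rcases mul_eq_zero.1 hsum with h1 | h1
    · exact h0 (h1 ▸ hu)
    · rw [Finset.prod_eq_zero_iff] at h1
      obtain ⟨a, ha, h2⟩ := h1
      exact (Finset.ne_of_mem_erase ha) (sub_eq_zero.1 h2).symm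
  · intro u huS hne
    simp only [f, eval_mul, eval_X, eval_prod, eval_sub, eval_C]
    rw [Finset.prod_eq_zero (Finset.mem_erase.2 ⟨hne, huS⟩) (sub_self u), mul_zero]
  · intro h; exact absurd hu h

/-- Burnside's theorem: a permutation which, relative to every point, permutes a small set `S`
of differences, is linear. -/
theorem burnside_linear {p : ℕ} [Fact p.Prime] (S : Finset (ZMod p)) (h0 : 0 ∉ S)
    (hne : S.Nonempty) (hsmall : 2 * S.card ≤ p - 1) (g : ZMod p → ZMod p) (hg0 : g 0 = 0)
    (hg : ∀ x, ∃ e : Perm (ZMod p), (∀ u, e u ∈ S ↔ u ∈ S) ∧ ∀ u, g (x + u) = g x + e u) :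
    ∃ α, ∀ x, g x = α * x := by
  classical
  have hp : p.Prime := Fact.out
  obtain ⟨P, hPdeg, hPe⟩ : ∃ P : (ZMod p)[X], P.natDegree < p ∧ ∀ x, P.eval x = g x := by
    refine ⟨Lagrange.interpolate Finset.univ id g, ?_, ?_⟩
    · have := Lagrange.degree_interpolate_lt (s := Finset.univ) (v := (id : ZMod p → ZMod p)) g
        Function.injective_id.injOn
      rw [Finset.card_univ, ZMod.card] at this
      by_cases hz : Lagrange.interpolate Finset.univ id g = 0
      · rw [hz]; simp [hp.pos]
      · exact (natDegree_lt_iff_degree_lt hz).2 this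
    · intro x
      exact Lagrange.eval_interpolate_at_node (v := (id : ZMod p → ZMod p)) g
        Function.injective_id.injOn (Finset.mem_univ x)
  have hex := exists_powersum S h0 hne
  obtain ⟨r, ⟨hr1, hrd, hr⟩, hmin⟩ : ∃ r, (1 ≤ r ∧ r ≤ S.card ∧ ∑ u ∈ S, u ^ r ≠ 0) ∧
      ∀ j, j < r → ¬ (1 ≤ j ∧ j ≤ S.card ∧ ∑ u ∈ S, u ^ j ≠ 0) :=
    ⟨Nat.find hex, Nat.find_spec hex, fun j hj => Nat.find_min hex hj⟩
  have hrm : ∀ j, 1 ≤ j → j < r → ∑ u ∈ S, u ^ j = 0 := by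
    intro j h1 h2
    by_contra h3
    exact hmin j h2 ⟨h1, by omega, h3⟩
  have hsum : ∀ k x, ∑ u ∈ S, g (x + u) ^ k
      = ∑ j ∈ Finset.range (k + 1), (∑ u ∈ S, u ^ j) * (g x ^ (k - j) * (k.choose j : ZMod p)) := by
    intro k x
    obtain ⟨e, he, hge⟩ := hg x
    have : ∑ u ∈ S, g (x + u) ^ k = ∑ u ∈ S, (u + g x) ^ k := by
      refine Finset.sum_bij (fun u _ => e u) (fun u hu => (he u).2 hu)
        (fun u _ v _ h => e.injective h) ?_ ?_
      · intro v hv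
        exact ⟨e.symm v, (he _).1 (by simpa using hv), by simp⟩
      · intro u _; rw [hge, add_comm]
    rw [this]
    simp only [add_pow]
    rw [Finset.sum_comm]
    refine Finset.sum_congr rfl fun j _ => ?_
    rw [Finset.sum_mul]
    refine Finset.sum_congr rfl fun u _ => ?_
    ring
  have hsumk : ∀ k, k < r → ∀ x, ∑ u ∈ S, g (x + u) ^ k = S.card * g x ^ k := by
    intro k hk x
    rw [hsum, Finset.sum_eq_single 0]
    · simp
    · intro j hj hj0
      rw [Finset.mem_range] at hj
      rw [hrm j (by omega) (by omega), zero_mul]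
    · simp
  have ht : P.natDegree ≤ 1 := by
    by_contra! ht
    rcases Nat.eq_or_lt_of_le hr1 with h1 | h1
    · refine taylor_key S r hr1 hr hrm P hPdeg (by omega) (∑ u ∈ S, u) (Or.inr (by omega)) ?_
      intro x
      have := hsum 1 x
      simp only [pow_one, Finset.sum_range_succ, Finset.sum_range_zero] at this
      simp only [hPe, this]
      simp
    · have main : ∀ k, k < r → r ≤ k * P.natDegree → k * P.natDegree < p → False := by
        intro k hk h2 h3
        refine taylor_key S r hr1 hr hrm (P ^ k) (by rwa [natDegree_pow]) (by rwa [natDegree_pow])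
          0 (Or.inl rfl) ?_
        intro x
        simp only [eval_pow, hPe, add_zero]
        exact hsumk k hk x
      rcases Nat.lt_or_ge P.natDegree r with h4 | h4
      · have hdm := Nat.div_add_mod (r - 1) P.natDegree
        have hml := Nat.mod_lt (r - 1) (show 0 < P.natDegree by omega)
        set k := (r - 1) / P.natDegree
        have hk2 : k * 2 ≤ r - 1 := by
          calc k * 2 ≤ P.natDegree * k := by rw [mul_comm]; exact Nat.mul_le_mul_right _ ht
            _ ≤ r - 1 := by omega
        refine main (k + 1) (by omega) ?_ ?_
        · rw [add_mul, mul_comm]; omega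
        · rw [add_mul, mul_comm k]; omega
      · exact main 1 h1 (by omega) (by omega)
  refine ⟨P.coeff 1, fun x => ?_⟩
  have h1 : ∀ x, g x = P.coeff 0 + P.coeff 1 * x := by
    intro x
    rw [← hPe, eval_eq_sum_range' (n := 2) (by omega)]
    simp [Finset.sum_range_succ]
  have h2 := h1 0
  rw [hg0, mul_zero, add_zero] at h2
  rw [h1 x, ← h2, zero_add]

end Burnside


section A6facts

/-- The alternating group on six points. -/
abbrev A6 := ↥(alternatingGroup (Fin 6))

theorem perm6_ord : ∀ g : Perm (Fin 6), Perm.sign g = 1 → g ^ 3 = 1 ∨ g ^ 4 = 1 ∨ g ^ 5 = 1 := by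
  decide +kernel

theorem perm6_inv_card : (Finset.univ.filter
    (fun g : Perm (Fin 6) => g ^ 2 = 1 ∧ g ≠ 1 ∧ Perm.sign g = 1)).card = 45 := by
  decide +kernel

theorem perm6_inv_supp : ∀ g : Perm (Fin 6), g ^ 2 = 1 → g ≠ 1 → Perm.sign g = 1 →
    g.support.card = 4 := by
  decide +kernel

theorem perm6_five_card : (Finset.univ.filter
    (fun g : Perm (Fin 6) => g ^ 5 = 1 ∧ g ≠ 1)).card = 144 := by
  decide +kernel

theorem A6_card : Fintype.card A6 = 360 := by
  have := two_mul_card_alternatingGroup (α := Fin 6)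
  rw [Fintype.card_perm, Fintype.card_fin, show Nat.factorial 6 = 720 from rfl] at this
  have h2 : Fintype.card A6 = Fintype.card (alternatingGroup (Fin 6)) := Fintype.card_congr (Equiv.refl _)
  rw [h2]
  omega

theorem A6_simple (N : Subgroup A6) (hN : N.Normal) : N = ⊥ ∨ N = ⊤ := by
  have : IsSimpleGroup A6 := alternatingGroup.isSimpleGroup (by simp)
  exact hN.eq_bot_or_eq_top

theorem A6_noncomm : ∃ a b : A6, a * b ≠ b * a := by
  refine ⟨⟨swap 0 1 * swap 1 2, by simp [Perm.mem_alternatingGroup]⟩,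
    ⟨swap 1 2 * swap 2 3, by simp [Perm.mem_alternatingGroup]⟩, ?_⟩
  intro h
  have := congrArg (fun g : A6 => (g : Perm (Fin 6)) 0) h
  revert this
  decide

theorem A6_ord (g : A6) : g ^ 3 = 1 ∨ g ^ 4 = 1 ∨ g ^ 5 = 1 := by
  have := perm6_ord g g.2
  simpa only [Subtype.ext_iff, Subgroup.coe_pow, Subgroup.coe_one] using this

theorem A6_inv_card :
    (Finset.univ.filter fun g : A6 => g ^ 2 = 1 ∧ g ≠ 1).card = 45 := by
  rw [← perm6_inv_card]
  refine Finset.card_bij (fun g _ => (g : Perm (Fin 6))) ?_ ?_ ?_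
  · intro g hg
    simp only [Finset.mem_filter, Finset.mem_univ, true_and, Ne, Subtype.ext_iff,
      Subgroup.coe_pow, Subgroup.coe_one] at hg ⊢
    exact ⟨hg.1, hg.2, g.2⟩
  · intro a _ b _ h; exact Subtype.ext h
  · intro g hg
    simp only [Finset.mem_filter, Finset.mem_univ, true_and] at hg
    refine ⟨⟨g, hg.2.2⟩, ?_, rfl⟩
    simp only [Finset.mem_filter, Finset.mem_univ, true_and, Ne, Subtype.ext_iff,
      Subgroup.coe_pow, Subgroup.coe_one]
    exact ⟨hg.1, hg.2.1⟩

theorem A6_five_card :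
    (Finset.univ.filter fun g : A6 => g ^ 5 = 1 ∧ g ≠ 1).card = 144 := by
  rw [← perm6_five_card]
  refine Finset.card_bij (fun g _ => (g : Perm (Fin 6))) ?_ ?_ ?_
  · intro g hg
    simp only [Finset.mem_filter, Finset.mem_univ, true_and, Ne, Subtype.ext_iff,
      Subgroup.coe_pow, Subgroup.coe_one] at hg ⊢
    exact hg
  · intro a _ b _ h; exact Subtype.ext h
  · intro g hg
    simp only [Finset.mem_filter, Finset.mem_univ, true_and] at hg
    have hs : Perm.sign g = 1 := by
      have h1 := congrArg Perm.sign hg.1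
      rw [map_pow, map_one] at h1
      rcases Int.units_eq_one_or (Perm.sign g) with h | h
      · exact h
      · rw [h] at h1; exact absurd h1 (by decide)
    refine ⟨⟨g, hs⟩, ?_, rfl⟩
    simp only [Finset.mem_filter, Finset.mem_univ, true_and, Ne, Subtype.ext_iff,
      Subgroup.coe_pow, Subgroup.coe_one]
    exact hg

theorem A6_inv_conj (a b : A6) (ha : a ^ 2 = 1) (ha' : a ≠ 1) (hb : b ^ 2 = 1) (hb' : b ≠ 1) :
    ∃ c : A6, c * a * c⁻¹ = b := by
  have key : ∀ a : A6, a ^ 2 = 1 → a ≠ 1 → (a : Perm (Fin 6)).cycleType = {2, 2} ∧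
      (a : Perm (Fin 6)).support.card = 4 := by
    intro a ha ha'
    have h1 : (a : Perm (Fin 6)) ^ 2 = 1 := by
      rw [← Subgroup.coe_pow, ha, Subgroup.coe_one]
    have h2 : (a : Perm (Fin 6)) ≠ 1 := fun h => ha' (Subtype.ext h)
    have h3 := perm6_inv_supp a h1 h2 a.2
    refine ⟨?_, h3⟩
    have h4 := Perm.cycleType_of_pow_prime_eq_one (p := 2) h1
    have h5 := Perm.sum_cycleType (a : Perm (Fin 6))
    rw [h3, h4] at h5
    simp at h5
    rw [h4, show Multiset.card (a : Perm (Fin 6)).cycleType = 2 by omega]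
    rfl
  have hc := alternatingGroup.isConj_of (σ := a) (τ := b)
    (Perm.isConj_of_cycleType_eq ((key a ha ha').1.trans (key b hb hb').1.symm))
    (by rw [(key a ha ha').2]; simp)
  exact isConj_iff.1 hc

/-- A homomorphism from `A6` to a commutative group kills everything. -/
theorem A6_hom_comm {M : Type*} [CommGroup M] (f : A6 →* M) (b : A6) : f b = 1 := by
  rcases A6_simple f.ker inferInstance with h | h
  · obtain ⟨x, y, hxy⟩ := A6_noncomm
    exfalso; apply hxy
    exact (MonoidHom.ker_eq_bot_iff f).1 h (by rw [map_mul, map_mul, mul_comm])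
  · have : b ∈ f.ker := by rw [h]; trivial
    exact this

end A6facts


section Transitive

variable {m : ℕ} [NeZero m]

theorem ctr_const {ρ : A6 →* Perm (ZMod m)}
    (htr : ∀ x y : ZMod m, x ≠ 0 → y ≠ 0 → ∃ b, ρ b x = y) {x y x' y' : ZMod m}
    (hx : x ≠ 0) (hy : y ≠ 0) (hx' : x' ≠ 0) (hy' : y' ≠ 0) :
    (Finset.univ.filter fun b : A6 => ρ b x = y).card =
      (Finset.univ.filter fun b : A6 => ρ b x' = y').card := by
  obtain ⟨c, hc⟩ := htr y y' hy hy'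
  obtain ⟨d, hd⟩ := htr x' x hx' hx
  refine Finset.card_bij' (fun b _ => c * b * d) (fun b _ => c⁻¹ * b * d⁻¹) ?_ ?_ ?_ ?_
  · intro b hb
    simp only [Finset.mem_filter, Finset.mem_univ, true_and, map_mul, Perm.mul_apply] at hb ⊢
    rw [hd, hb, hc]
  · intro b hb
    simp only [Finset.mem_filter, Finset.mem_univ, true_and, map_mul, Perm.mul_apply, map_inv] at hb ⊢
    rw [← hd, ← hc] at *
    simp [hb]
  · intro b _; group
  · intro b _; group

theorem card_ge {ρ : A6 →* Perm (ZMod m)} (hinj : Function.Injective ρ) :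
    360 ≤ Nat.factorial m := by
  have := Fintype.card_le_of_injective ρ hinj
  rwa [A6_card, Fintype.card_perm, ZMod.card] at this

theorem m_ge {ρ : A6 →* Perm (ZMod m)} (hinj : Function.Injective ρ) : 6 ≤ m := by
  by_contra h
  have h1 := card_ge hinj
  have h2 := Nat.factorial_le (show m ≤ 5 by omega)
  have : Nat.factorial 5 = 120 := rfl
  omega

/-- Sum over a function on `ZMod m` constant away from zero. -/
theorem sum_const_off_zero (f : ZMod m → ℕ) (c : ℕ) (hf : ∀ x, x ≠ 0 → f x = c) :
    ∑ x, f x = f 0 + (m - 1) * c := by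
  rw [← Finset.add_sum_erase Finset.univ f (Finset.mem_univ 0)]
  congr 1
  rw [Finset.sum_congr rfl (fun x hx => hf x (Finset.ne_of_mem_erase hx)), Finset.sum_const,
    Finset.card_erase_of_mem (Finset.mem_univ _), Finset.card_univ, ZMod.card, smul_eq_mul]

theorem rho_ne_zero {ρ : A6 →* Perm (ZMod m)} (h0 : ∀ b, ρ b 0 = 0) (b : A6) {x : ZMod m}
    (hx : x ≠ 0) : ρ b x ≠ 0 := by
  intro h; exact hx ((ρ b).injective (h.trans (h0 b).symm))

theorem ctr_total {ρ : A6 →* Perm (ZMod m)} (h0 : ∀ b, ρ b 0 = 0)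
    (htr : ∀ x y : ZMod m, x ≠ 0 → y ≠ 0 → ∃ b, ρ b x = y) {x y : ZMod m}
    (hx : x ≠ 0) (hy : y ≠ 0) :
    (m - 1) * (Finset.univ.filter fun b : A6 => ρ b x = y).card = 360 := by
  have h1 := sum_const_off_zero
    (fun y' => (Finset.univ.filter fun b : A6 => ρ b x = y').card) _
    (fun y' hy' => ctr_const htr hx hy' hx hy)
  have h2 : (Finset.univ.filter fun b : A6 => ρ b x = 0).card = 0 := by
    rw [Finset.card_eq_zero, Finset.filter_eq_empty_iff]
    intro b _; exact rho_ne_zero h0 b hx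
  rw [h2, zero_add] at h1
  rw [← h1, ← A6_card, ← Finset.card_univ]
  exact (Finset.card_eq_sum_card_fiberwise (fun b _ => Finset.mem_univ (ρ b x))).symm

theorem sign_add_one (hm : Even m) (hm0 : m ≠ 0) : Perm.sign (Equiv.addLeft (1 : ZMod m)) = -1 := by
  obtain ⟨n, rfl⟩ := Nat.exists_eq_succ_of_ne_zero hm0
  have h2 : Perm.sign (Equiv.addLeft (1 : ZMod (n+1))) = Perm.sign (finRotate (n+1)) := by
    refine Perm.sign_bij (f := Equiv.addLeft (1 : ZMod (n+1))) (g := finRotate (n+1))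
      (fun (x : ZMod (n+1)) _ => (x : Fin (n+1))) ?_ ?_ ?_
    · intro (x : Fin (n+1)) hx hx'
      change ((1 : Fin (n+1)) + x : Fin (n+1)) = finRotate (n+1) x
      rw [finRotate_apply]
      exact add_comm _ _
    · intro x y hx hy h; exact h
    · intro (x : Fin (n+1)) hx
      refine ⟨x, ?_, rfl⟩
      intro h; apply hx
      rw [finRotate_apply]
      exact (add_comm _ _).trans h
  rw [h2, sign_finRotate]
  have : Odd n := by
    rcases Nat.even_or_odd n with h | h
    · exact absurd hm (by simpa [Nat.even_add_one] using h)
    · exact h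
  exact this.neg_one_pow

theorem m_odd {ρ : A6 →* Perm (ZMod m)} {τ : ZMod m → A6 → A6}
    (hτ : ∀ b x y, ρ b (x + y) = ρ b x + ρ (τ x b) y)
    (hinj : Function.Injective ρ)
    (hprim : ∀ D : AddSubgroup (ZMod m), (∀ b, ∀ x ∈ D, ρ b x ∈ D) → D = ⊥ ∨ D = ⊤) :
    ¬ Even m := by
  intro hev
  have hm := m_ge hinj
  have hs : ∀ b, Perm.sign (ρ b) = 1 := fun b => A6_hom_comm (Perm.sign.comp ρ) b
  have hadd : ∀ x y : ZMod m, Equiv.addLeft (x + y) = Equiv.addLeft x * Equiv.addLeft y := by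
    intro x y; ext z; simp [add_assoc]
  let D : AddSubgroup (ZMod m) :=
    { carrier := {x | Perm.sign (Equiv.addLeft x) = 1}
      zero_mem' := by
        have : Equiv.addLeft (0 : ZMod m) = 1 := by ext z; simp
        simp [this]
      add_mem' := by
        intro x y hx hy
        simp only [Set.mem_ofPred_eq] at *
        rw [hadd, map_mul, hx, hy, one_mul]
      neg_mem' := by
        intro x hx
        simp only [Set.mem_ofPred_eq] at *
        have : Equiv.addLeft (-x) * Equiv.addLeft x = 1 := by ext z; simp
        have h := congrArg Perm.sign this
        rwa [map_mul, hx, mul_one, map_one] at h }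
  have hD := hprim D (by
    intro b x hx
    change Perm.sign (Equiv.addLeft (ρ b x)) = 1
    have hx' : Perm.sign (Equiv.addLeft x) = 1 := hx
    have e : ρ b * Equiv.addLeft x = Equiv.addLeft (ρ b x) * ρ (τ x b) := by
      ext y; simp [hτ]
    have h := congrArg Perm.sign e
    rwa [map_mul, map_mul, hs, hs, hx', one_mul, mul_one, eq_comm] at h)
  rcases hD with hD | hD
  · have h2 : (1 + 1 : ZMod m) ∈ D := by
      change Perm.sign (Equiv.addLeft (1 + 1 : ZMod m)) = 1
      rw [hadd, map_mul]; exact Int.units_mul_self _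
    rw [hD, AddSubgroup.mem_bot] at h2
    have h3 : ((2 : ℕ) : ZMod m) = 0 := by push_cast; rw [← h2]; norm_num
    rw [ZMod.natCast_eq_zero_iff] at h3
    have := Nat.le_of_dvd (by norm_num) h3
    omega
  · have h1 : (1 : ZMod m) ∈ D := by rw [hD]; trivial
    have h1' : Perm.sign (Equiv.addLeft (1 : ZMod m)) = 1 := h1
    rw [sign_add_one hev (by omega)] at h1'
    exact absurd h1' (by decide)

theorem tau_add {ρ : A6 →* Perm (ZMod m)} {τ : ZMod m → A6 → A6}
    (hτ : ∀ b x y, ρ b (x + y) = ρ b x + ρ (τ x b) y)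
    (hinj : Function.Injective ρ) (x y : ZMod m) (b : A6) :
    τ (x + y) b = τ y (τ x b) := by
  apply hinj
  ext z
  have h1 := hτ b (x + y) z
  rw [add_assoc, hτ b x (y + z), hτ (τ x b) y z, hτ b x y, add_assoc] at h1
  have := add_left_cancel (add_left_cancel h1)
  rw [this]

theorem tau_zero {ρ : A6 →* Perm (ZMod m)} {τ : ZMod m → A6 → A6} (h0 : ∀ b, ρ b 0 = 0)
    (hτ : ∀ b x y, ρ b (x + y) = ρ b x + ρ (τ x b) y)
    (hinj : Function.Injective ρ) (b : A6) : τ 0 b = b := by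
  apply hinj
  ext z
  have h1 := hτ b 0 z
  rw [zero_add, h0, zero_add] at h1
  rw [h1]

theorem lin_small {p : ℕ} [Fact p.Prime] {ρ : A6 →* Perm (ZMod p)}
    (hinj : Function.Injective ρ) :
    Nat.card {b : A6 // ∀ y, ρ b y = y * ρ b 1} ≤ 5 := by
  let E : Subgroup A6 :=
    { carrier := {b | ∀ y, ρ b y = y * ρ b 1}
      one_mem' := by intro y; simp
      mul_mem' := by
        intro a b ha hb y
        simp only [Set.mem_ofPred_eq] at ha hb
        rw [map_mul, Perm.mul_apply, Perm.mul_apply, hb y, ha, ha (ρ b 1), mul_assoc]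
      inv_mem' := by
        intro a ha y
        simp only [Set.mem_ofPred_eq] at ha
        apply (ρ a).injective
        have h2 : ρ a ((ρ a⁻¹) 1) = 1 := by simp
        rw [ha] at h2
        rw [ha (y * _), mul_assoc, h2, mul_one]
        simp }
  let f : E →* ZMod p :=
    { toFun := fun b => ρ b.1 1
      map_one' := by simp
      map_mul' := by
        intro a b
        simp only [Subgroup.coe_mul, map_mul, Perm.mul_apply]
        rw [a.2 (ρ b.1 1), mul_comm] }
  have hf : Function.Injective f := by
    intro a b hab
    apply Subtype.ext
    apply hinj
    ext y
    have : ρ a.1 1 = ρ b.1 1 := hab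
    rw [a.2 y, b.2 y, this]
  have hc : IsCyclic E := isCyclic_of_injective_ringHom f hf
  obtain ⟨g, hg⟩ := hc.exists_ofOrder_eq_natCard
  change Nat.card E ≤ 5
  rw [← hg]
  have : orderOf g ≤ 5 := by
    rcases A6_ord g.1 with h | h | h
    · have := orderOf_le_of_pow_eq_one (x := g) (n := 3) (by norm_num) (Subtype.ext h); omega
    · have := orderOf_le_of_pow_eq_one (x := g) (n := 4) (by norm_num) (Subtype.ext h); omega
    · have := orderOf_le_of_pow_eq_one (x := g) (n := 5) (by norm_num) (Subtype.ext h); omega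
  exact this

theorem prime_mod {p : ℕ} [hp : Fact p.Prime] {ρ : A6 →* Perm (ZMod p)} {τ : ZMod p → A6 → A6}
    (h0 : ∀ b, ρ b 0 = 0)
    (hτ : ∀ b x y, ρ b (x + y) = ρ b x + ρ (τ x b) y)
    (hinj : Function.Injective ρ) : ∃ e, e ≤ 5 ∧ 360 ≡ e [MOD p] := by
  classical
  let f : Function.End A6 := τ 1
  have hit : ∀ (i : ℕ) (b : A6), (τ 1)^[i] b = τ (i : ZMod p) b := by
    intro i
    induction i with
    | zero => intro b; simp [tau_zero h0 hτ hinj]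
    | succ n ih =>
      intro b
      rw [Function.iterate_succ_apply', ih, ← tau_add hτ hinj]; push_cast; rfl
  have hpow : ∀ (i : ℕ) , f ^ i = (τ 1)^[i] := by
    intro i
    induction i with
    | zero => rfl
    | succ n ih => rw [pow_succ, ih, Function.iterate_succ]; rfl
  have hf : f ^ p ^ 1 = 1 := by
    rw [pow_one, hpow]
    funext b
    rw [hit, ZMod.natCast_self, tau_zero h0 hτ hinj]; rfl
  have h := Equiv.Perm.card_fixedPoints_modEq hf
  rw [A6_card] at h
  refine ⟨_, ?_, h⟩
  refine le_trans ?_ (lin_small hinj)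
  rw [← Nat.card_eq_fintype_card]
  refine Nat.card_le_card_of_injective (fun b => ⟨b.1, ?_⟩) ?_
  · have hb : τ 1 b.1 = b.1 := b.2
    have h1 : ∀ i : ℕ, ρ b.1 (i : ZMod p) = i * ρ b.1 1 := by
      intro i
      induction i with
      | zero => simp [h0]
      | succ n ih =>
        push_cast
        rw [add_comm (n : ZMod p) 1, hτ, hb, ih]; ring
    intro y
    have := h1 y.val
    rwa [ZMod.natCast_zmod_val] at this
  · intro a b hab
    exact Subtype.ext (congrArg (fun z => z.1) hab)

end Transitive


section TransitiveTwo

variable {m : ℕ} [NeZero m]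

/-- Involutions of the complementary product `t_x ρ(b)`. -/
def IsHInv (ρ : A6 →* Perm (ZMod m)) (h : Perm (ZMod m)) : Prop :=
  h * h = 1 ∧ h ≠ 1 ∧ ∃ b, ∀ y, h y = h 0 + ρ b y

theorem IsHInv.conj_add {ρ : A6 →* Perm (ZMod m)} {τ : ZMod m → A6 → A6}
    (hτ : ∀ b x y, ρ b (x + y) = ρ b x + ρ (τ x b) y) {h : Perm (ZMod m)} (hh : IsHInv ρ h)
    (y : ZMod m) : IsHInv ρ (Equiv.addLeft y * h * (Equiv.addLeft y)⁻¹) := by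
  obtain ⟨h1, h2, b, hb⟩ := hh
  refine ⟨?_, ?_, τ (-y) b, ?_⟩
  · calc _ = Equiv.addLeft y * (h * h) * (Equiv.addLeft y)⁻¹ := by group
      _ = 1 := by rw [h1]; group
  · intro h; exact h2 (conj_eq_one_iff.1 h)
  · intro z
    simp only [Perm.mul_apply, Perm.inv_def, Equiv.addLeft_symm, Equiv.coe_addLeft, add_zero]
    rw [hb (-y + z), hτ, hb (-y)]
    ring

theorem IsHInv.conj_rho {ρ : A6 →* Perm (ZMod m)} {τ : ZMod m → A6 → A6}
    (h0 : ∀ b, ρ b 0 = 0)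
    (hτ : ∀ b x y, ρ b (x + y) = ρ b x + ρ (τ x b) y) {h : Perm (ZMod m)} (hh : IsHInv ρ h)
    (c : A6) : IsHInv ρ (ρ c * h * (ρ c)⁻¹) := by
  obtain ⟨h1, h2, b, hb⟩ := hh
  refine ⟨?_, ?_, τ (h 0) c * b * c⁻¹, ?_⟩
  · calc _ = ρ c * (h * h) * (ρ c)⁻¹ := by group
      _ = 1 := by rw [h1]; group
  · intro h; exact h2 (conj_eq_one_iff.1 h)
  · intro z
    have h0' : (ρ c)⁻¹ 0 = 0 := by rw [← map_inv]; exact h0 _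
    simp only [Perm.mul_apply, map_mul, map_inv, h0']
    rw [hb, hτ]

theorem isHInv_rho {ρ : A6 →* Perm (ZMod m)} (h0 : ∀ b, ρ b 0 = 0)
    (hinj : Function.Injective ρ) (b : A6) : IsHInv ρ (ρ b) ↔ (b ^ 2 = 1 ∧ b ≠ 1) := by
  constructor
  · rintro ⟨h1, h2, -⟩
    refine ⟨hinj (by rw [pow_two, map_mul, h1, map_one]), ?_⟩
    rintro rfl; exact h2 (map_one _)
  · rintro ⟨h1, h2⟩
    refine ⟨by rw [← map_mul, ← pow_two, h1, map_one], ?_, b, fun y => by rw [h0, zero_add]⟩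
    intro h; exact h2 (hinj (h.trans (map_one _).symm))

theorem fix_conj (h c : Perm (ZMod m)) :
    (Finset.univ.filter fun y => (c * h * c⁻¹) y = y).card =
      (Finset.univ.filter fun y => h y = y).card := by
  refine Finset.card_bij' (fun y _ => c⁻¹ y) (fun y _ => c y) ?_ ?_ ?_ ?_
  · intro y hy
    rw [Finset.mem_filter] at hy ⊢
    refine ⟨Finset.mem_univ _, ?_⟩
    have h2 := hy.2
    rw [Perm.mul_apply, Perm.mul_apply] at h2
    conv_rhs => rw [← h2]
    simp
  · intro y hy
    rw [Finset.mem_filter] at hy ⊢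
    refine ⟨Finset.mem_univ _, ?_⟩
    simp [hy.2]
  · intro y _; simp
  · intro y _; simp

theorem inv_has_fix (hodd : ¬ Even m) (h : Perm (ZMod m)) (hh : h * h = 1) : ∃ y, h y = y := by
  have : Fact (Nat.Prime 2) := ⟨Nat.prime_two⟩
  by_contra hcon
  push Not at hcon
  have h1 := Equiv.Perm.card_compl_support_modEq (p := 2) (n := 1) (σ := h)
    (by rw [pow_one, pow_two, hh])
  have h2 : h.supportᶜ = ∅ := by
    rw [Finset.eq_empty_iff_forall_notMem]
    intro y hy
    rw [Finset.mem_compl, Perm.mem_support, not_not] at hy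
    exact hcon y hy
  rw [h2, Finset.card_empty, ZMod.card] at h1
  exact hodd ((Nat.even_iff).2 h1.symm)

open Classical in
theorem inv_count {ρ : A6 →* Perm (ZMod m)} {τ : ZMod m → A6 → A6} (h0 : ∀ b, ρ b 0 = 0)
    (hτ : ∀ b x y, ρ b (x + y) = ρ b x + ρ (τ x b) y)
    (hinj : Function.Injective ρ)
    (htr : ∀ x y : ZMod m, x ≠ 0 → y ≠ 0 → ∃ b, ρ b x = y) (hodd : ¬ Even m) :
    ∃ s i j k, (m - 1) * k = 360 ∧ s < k ∧ i ≤ k ∧ 45 * j = 45 + (m - 1) * s ∧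
      (45 + (m - 1) * i) * j = 45 * m := by
  have hm := m_ge hinj
  have : Fact (1 < m) := ⟨by omega⟩
  set I : Finset A6 := Finset.univ.filter fun g : A6 => g ^ 2 = 1 ∧ g ≠ 1 with hI
  have hIc : I.card = 45 := by
    rw [← A6_inv_card, hI]
  obtain ⟨c0, hc0⟩ : I.Nonempty := by rw [← Finset.card_pos, hIc]; norm_num
  have hc0' : c0 ^ 2 = 1 ∧ c0 ≠ 1 := by simpa [hI] using hc0
  set IH : Finset (Perm (ZMod m)) := Finset.univ.filter fun h => IsHInv ρ h with hIH
  set fx : Perm (ZMod m) → ℕ := fun h => (Finset.univ.filter fun y => h y = y).card with hfx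
  have hfI : ∀ c ∈ I, fx (ρ c) = fx (ρ c0) := by
    intro c hc
    have hc' : c ^ 2 = 1 ∧ c ≠ 1 := by simpa [hI] using hc
    obtain ⟨d, rfl⟩ := A6_inv_conj c0 c hc0'.1 hc0'.2 hc'.1 hc'.2
    rw [map_mul, map_mul, map_inv]
    exact fix_conj _ _
  -- involutions fixing zero
  have hzero : ∀ h, IsHInv ρ h → h 0 = 0 → ∃ b ∈ I, h = ρ b := by
    intro h hh h00
    obtain ⟨b, hb⟩ := hh.2.2
    have e : h = ρ b := by ext y; rw [hb, h00, zero_add]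
    refine ⟨b, ?_, e⟩
    have := (isHInv_rho h0 hinj b).1 (e ▸ hh)
    simpa [hI] using this
  have hF0 : (IH.filter fun h => h 0 = 0).card = 45 := by
    rw [← hIc]
    symm
    refine Finset.card_bij (fun b _ => ρ b) ?_ ?_ ?_
    · intro b hb
      simp only [hIH, Finset.mem_filter, Finset.mem_univ, true_and]
      exact ⟨(isHInv_rho h0 hinj b).2 (by simpa [hI] using hb), h0 b⟩
    · intro a _ b _ h; exact hinj h
    · intro h hh
      simp only [hIH, Finset.mem_filter, Finset.mem_univ, true_and] at hh
      obtain ⟨b, hb, e⟩ := hzero h hh.1 hh.2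
      exact ⟨b, hb, e.symm⟩
  have hF : ∀ y, (IH.filter fun h => h y = y).card = 45 := by
    intro y
    rw [← hF0]
    refine Finset.card_bij' (fun h _ => Equiv.addLeft (-y) * h * (Equiv.addLeft (-y))⁻¹)
      (fun h _ => Equiv.addLeft y * h * (Equiv.addLeft y)⁻¹) ?_ ?_ ?_ ?_
    · intro h hh
      simp only [hIH, Finset.mem_filter, Finset.mem_univ, true_and] at hh ⊢
      refine ⟨hh.1.conj_add hτ _, ?_⟩
      simp [Perm.inv_def, hh.2]
    · intro h hh
      simp only [hIH, Finset.mem_filter, Finset.mem_univ, true_and] at hh ⊢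
      refine ⟨hh.1.conj_add hτ _, ?_⟩
      simp [Perm.inv_def, hh.2]
    · intro h _; ext z; simp [Perm.inv_def]
    · intro h _; ext z; simp [Perm.inv_def]
  have hfH : ∀ h ∈ IH, fx h = fx (ρ c0) := by
    intro h hh
    have hh' : IsHInv ρ h := by simpa [hIH] using hh
    obtain ⟨y, hy⟩ := inv_has_fix hodd h hh'.1
    have h1 := hh'.conj_add hτ (-y)
    obtain ⟨b, hb, e⟩ := hzero _ h1 (by simp [Perm.inv_def, hy])
    rw [← hfI b hb, ← e]
    exact (fix_conj _ _).symm
  have hTj : IH.card * fx (ρ c0) = 45 * m := by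
    have h1 : ∑ h ∈ IH, fx h = ∑ y : ZMod m, (IH.filter fun h => h y = y).card :=
      Finset.sum_card_bipartiteAbove_eq_sum_card_bipartiteBelow (fun (h : Perm (ZMod m)) y => h y = y)
    rw [Finset.sum_congr rfl hfH, Finset.sum_const, Finset.sum_congr rfl (fun y _ => hF y),
      Finset.sum_const, Finset.card_univ, ZMod.card, smul_eq_mul, smul_eq_mul] at h1
    rw [h1, mul_comm]
  have hG : ∀ x, x ≠ 0 → (IH.filter fun h => h 0 = x).card =
      (IH.filter fun h => h 0 = (1 : ZMod m)).card := by
    intro x hx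
    obtain ⟨c, hc⟩ := htr x 1 hx one_ne_zero
    have hc' : (ρ c).symm 1 = x := by rw [← hc]; simp
    have h0' : (ρ c).symm 0 = 0 := by rw [← Perm.inv_def, ← map_inv]; exact h0 _
    refine Finset.card_bij' (fun h _ => ρ c * h * (ρ c)⁻¹)
      (fun h _ => ρ c⁻¹ * h * (ρ c⁻¹)⁻¹) ?_ ?_ ?_ ?_
    · intro h hh
      simp only [hIH, Finset.mem_filter, Finset.mem_univ, true_and] at hh ⊢
      refine ⟨hh.1.conj_rho h0 hτ _, ?_⟩
      simp [h0', hh.2, hc]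
    · intro h hh
      simp only [hIH, Finset.mem_filter, Finset.mem_univ, true_and] at hh ⊢
      refine ⟨hh.1.conj_rho h0 hτ _, ?_⟩
      simp [h0, hh.2, hc']
    · intro h _; simp [mul_assoc]
    · intro h _; simp [mul_assoc]
  have hT : IH.card = 45 + (m - 1) * (IH.filter fun h => h 0 = (1 : ZMod m)).card := by
    rw [← hF0, ← sum_const_off_zero (fun x => (IH.filter fun h => h 0 = x).card) _ hG]
    exact Finset.card_eq_sum_card_fiberwise (fun h _ => Finset.mem_univ (h 0))
  have hi : (IH.filter fun h => h 0 = (1 : ZMod m)).card ≤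
      (Finset.univ.filter fun b : A6 => ρ b 1 = -1).card := by
    have hch : ∀ h : Perm (ZMod m), ∃ b : A6, IsHInv ρ h → ∀ y, h y = h 0 + ρ b y := by
      intro h
      by_cases hh : IsHInv ρ h
      · obtain ⟨b, hb⟩ := hh.2.2; exact ⟨b, fun _ => hb⟩
      · exact ⟨1, fun h' => absurd h' hh⟩
    choose β hβ using hch
    refine Finset.card_le_card_of_injOn β ?_ ?_
    · intro h hh
      simp only [hIH, Finset.coe_filter, Finset.mem_filter, Finset.mem_univ, true_and, Set.mem_ofPred_eq] at hh ⊢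
      have h1 := hβ h hh.1 1
      have h2 : h (h 0) = 0 := by rw [← Perm.mul_apply, hh.1.1]; rfl
      rw [hh.2] at h1 h2
      rw [h2] at h1
      exact (neg_eq_of_add_eq_zero_right h1.symm).symm
    · intro h hh h' hh' e
      simp only [hIH, Finset.coe_filter, Finset.mem_filter, Finset.mem_univ, true_and, Set.mem_ofPred_eq] at hh hh'
      ext y
      rw [hβ h hh.1, hβ h' hh'.1, e, hh.2, hh'.2]
  -- the first count
  have hs : ∀ x, x ≠ 0 → (I.filter fun c => ρ c x = x).card =
      (I.filter fun c => ρ c (1 : ZMod m) = 1).card := by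
    intro x hx
    obtain ⟨c, hc⟩ := htr x 1 hx one_ne_zero
    have hc' : (ρ c).symm 1 = x := by rw [← hc]; simp
    have hcj : ∀ (c b : A6), (b ^ 2 = 1 ∧ b ≠ 1) → ((c * b * c⁻¹) ^ 2 = 1 ∧ c * b * c⁻¹ ≠ 1) := by
      rintro c b ⟨h1, h2⟩
      refine ⟨by rw [conj_pow, h1]; group, ?_⟩
      intro h; exact h2 (conj_eq_one_iff.1 h)
    refine Finset.card_bij' (fun h _ => c * h * c⁻¹)
      (fun h _ => c⁻¹ * h * (c⁻¹)⁻¹) ?_ ?_ ?_ ?_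
    · intro h hh
      simp only [hI, Finset.mem_filter, Finset.mem_univ, true_and] at hh ⊢
      refine ⟨hcj _ _ hh.1, ?_⟩
      simp [hh.2, hc, hc']
    · intro h hh
      simp only [hI, Finset.mem_filter, Finset.mem_univ, true_and] at hh ⊢
      refine ⟨hcj _ _ hh.1, ?_⟩
      simp [hh.2, hc, hc']
    · intro h _; group
    · intro h _; group
  have hj : 45 * fx (ρ c0) = 45 + (m - 1) * (I.filter fun c => ρ c (1 : ZMod m) = 1).card := by
    have h1 : ∑ h ∈ I, fx (ρ h) = ∑ y : ZMod m, (I.filter fun h => ρ h y = y).card :=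
      Finset.sum_card_bipartiteAbove_eq_sum_card_bipartiteBelow (fun (h : A6) y => ρ h y = y)
    rw [Finset.sum_congr rfl hfI, Finset.sum_const, hIc, smul_eq_mul,
      sum_const_off_zero _ _ hs] at h1
    rw [h1, Finset.filter_true_of_mem (fun c _ => h0 c), hIc]
  have hsk : (I.filter fun c => ρ c (1 : ZMod m) = 1).card <
      (Finset.univ.filter fun b : A6 => ρ b 1 = -1).card := by
    rw [ctr_const htr one_ne_zero (neg_ne_zero.2 one_ne_zero) one_ne_zero one_ne_zero]
    refine Finset.card_lt_card ?_
    rw [Finset.ssubset_iff_of_subset]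
    · exact ⟨1, by simp, by simp [hI]⟩
    · intro c hc
      simp only [Finset.mem_filter, Finset.mem_univ, true_and] at hc ⊢
      exact hc.2
  refine ⟨_, _, _, _, ctr_total h0 htr one_ne_zero (neg_ne_zero.2 one_ne_zero), hsk, hi, hj, ?_⟩
  rw [← hT, hTj]

theorem not_nine {ρ : A6 →* Perm (ZMod 9)} (h0 : ∀ b, ρ b 0 = 0)
    (htr : ∀ x y : ZMod 9, x ≠ 0 → y ≠ 0 → ∃ b, ρ b x = y) : False := by
  have h5 : Fact (Nat.Prime 5) := ⟨Nat.prime_five⟩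
  set I : Finset A6 := Finset.univ.filter fun g : A6 => g ^ 5 = 1 ∧ g ≠ 1 with hI
  have hIc : I.card = 144 := A6_five_card
  have h1 : ∑ h ∈ I, (Finset.univ.filter fun y => ρ h y = y).card =
      ∑ y : ZMod 9, (I.filter fun h => ρ h y = y).card :=
    Finset.sum_card_bipartiteAbove_eq_sum_card_bipartiteBelow (fun (h : A6) y => ρ h y = y)
  have h2 : 144 * 4 ≤ ∑ h ∈ I, (Finset.univ.filter fun y => ρ h y = y).card := by
    rw [← hIc, ← smul_eq_mul]
    refine Finset.card_nsmul_le_sum _ _ _ ?_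
    intro c hc
    have hc' : c ^ 5 = 1 ∧ c ≠ 1 := by simpa [hI] using hc
    have e := Equiv.Perm.card_compl_support_modEq (p := 5) (n := 1) (σ := ρ c)
      (by rw [pow_one, ← map_pow, hc'.1, map_one])
    have e2 : (ρ c).supportᶜ = (Finset.univ.filter fun y => ρ c y = y) := by
      ext y; simp
    rw [e2, ZMod.card] at e
    unfold Nat.ModEq at e
    omega
  have h3 : ∑ y : ZMod 9, (I.filter fun h => ρ h y = y).card ≤ 144 + 8 * 45 := by
    rw [← Finset.add_sum_erase Finset.univ _ (Finset.mem_univ (0 : ZMod 9))]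
    refine add_le_add ((Finset.card_filter_le _ _).trans hIc.le) ?_
    refine (Finset.sum_le_card_nsmul _ _ 45 ?_).trans (by decide)
    intro x hx
    have hx0 := Finset.ne_of_mem_erase hx
    have := ctr_total h0 htr hx0 hx0
    refine (Finset.card_le_card (Finset.filter_subset_filter _ (Finset.subset_univ I))).trans ?_
    omega
  omega

/-- The transitive case forces degree seven. -/
theorem trans_seven {ρ : A6 →* Perm (ZMod m)} {τ : ZMod m → A6 → A6} (h0 : ∀ b, ρ b 0 = 0)
    (hτ : ∀ b x y, ρ b (x + y) = ρ b x + ρ (τ x b) y)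
    (hinj : Function.Injective ρ)
    (hprim : ∀ D : AddSubgroup (ZMod m), (∀ b, ∀ x ∈ D, ρ b x ∈ D) → D = ⊥ ∨ D = ⊤)
    (htr : ∀ x y : ZMod m, x ≠ 0 → y ≠ 0 → ∃ b, ρ b x = y) : m = 7 := by
  have hm := m_ge hinj
  have hodd := m_odd hτ hinj hprim
  obtain ⟨s, i, j, k, hk, hs, hi, hj, hT⟩ := inv_count h0 hτ hinj htr hodd
  have hmul : (45 + (m - 1) * i) * (45 + (m - 1) * s) = 45 * 45 * m := by
    rw [← hj, mul_left_comm, hT, mul_assoc]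
  have hmem : m - 1 ∈ (Nat.divisors 360).filter (fun d => 5 ≤ d ∧ ¬ Even (d + 1)) := by
    rw [Finset.mem_filter, Nat.mem_divisors]
    refine ⟨⟨⟨k, hk.symm⟩, by norm_num⟩, by omega, ?_⟩
    rwa [Nat.sub_add_cancel (by omega)]
  have hlist : (Nat.divisors 360).filter (fun d => 5 ≤ d ∧ ¬ Even (d + 1)) =
    {6, 8, 10, 12, 18, 20, 24, 30, 36, 40, 60, 72, 90, 120, 180, 360} := by decide +kernel
  rw [hlist] at hmem
  simp only [Finset.mem_insert, Finset.mem_singleton] at hmem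
  have kill : ∀ d k s i : ℕ, d ∈ ({20, 24, 30, 40, 60, 72, 90, 120, 180, 360} : Finset ℕ) →
      d * k = 360 → s < k → i ≤ k → 45 ∣ d * s → (45 + d * i) * (45 + d * s) = 45 * 45 * (d + 1) → False := by
    have key : ∀ d ∈ ({20, 24, 30, 40, 60, 72, 90, 120, 180, 360} : Finset ℕ), ∀ s < 360 / d,
      ∀ i ≤ 360 / d, 45 ∣ d * s → (45 + d * i) * (45 + d * s) ≠ 45 * 45 * (d + 1) := by decide +kernel
    intro d k s i hd hk hs hi
    have hd0 : 0 < d := by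
      rcases Nat.eq_zero_or_pos d with h | h
      · rw [h, zero_mul] at hk; omega
      · exact h
    have : k = 360 / d := by rw [← hk, Nat.mul_div_cancel_left _ hd0]
    subst this
    exact key d hd s hs i hi
  have hm1 : m = (m - 1) + 1 := by omega
  by_cases hbig : m - 1 ∈ ({20, 24, 30, 40, 60, 72, 90, 120, 180, 360} : Finset ℕ)
  · exact (kill (m - 1) k s i hbig hk hs hi ((Nat.dvd_add_right (dvd_refl 45)).1 ⟨j, hj.symm⟩) (by rw [← hm1]; exact hmul)).elim
  · have hcases : m = 7 ∨ m = 9 ∨ m = 11 ∨ m = 13 ∨ m = 19 ∨ m = 37 := by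
      simp only [Finset.mem_insert, Finset.mem_singleton] at hbig
      omega
    rcases hcases with h | h | h | h | h | h
    · exact h
    · subst h; exact (not_nine h0 htr).elim
    all_goals
      subst h
      exfalso
    · have : Fact (Nat.Prime 11) := ⟨by norm_num⟩
      obtain ⟨e, he, h⟩ := prime_mod h0 hτ hinj
      unfold Nat.ModEq at h; omega
    · have : Fact (Nat.Prime 13) := ⟨by norm_num⟩
      obtain ⟨e, he, h⟩ := prime_mod h0 hτ hinj
      unfold Nat.ModEq at h; omega
    · have : Fact (Nat.Prime 19) := ⟨by norm_num⟩
      obtain ⟨e, he, h⟩ := prime_mod h0 hτ hinj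
      unfold Nat.ModEq at h; omega
    · have : Fact (Nat.Prime 37) := ⟨by norm_num⟩
      obtain ⟨e, he, h⟩ := prime_mod h0 hτ hinj
      unfold Nat.ModEq at h; omega

end TransitiveTwo


section Primitive

theorem prim_seven {m : ℕ} [NeZero m] {ρ : A6 →* Perm (ZMod m)} {τ : ZMod m → A6 → A6}
    (h0 : ∀ b, ρ b 0 = 0)
    (hτ : ∀ b x y, ρ b (x + y) = ρ b x + ρ (τ x b) y)
    (hinj : Function.Injective ρ)
    (hprim : ∀ D : AddSubgroup (ZMod m), (∀ b, ∀ x ∈ D, ρ b x ∈ D) → D = ⊥ ∨ D = ⊤) :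
    m = 7 := by
  by_cases htr : ∀ x y : ZMod m, x ≠ 0 → y ≠ 0 → ∃ b, ρ b x = y
  · exact trans_seven h0 hτ hinj hprim htr
  exfalso
  push Not at htr
  obtain ⟨x, y, hx, hy, hxy⟩ := htr
  have hm := m_ge hinj
  set O : ZMod m → Finset (ZMod m) := fun x => Finset.univ.image (fun b : A6 => ρ b x) with hO
  have hmemO : ∀ x z, z ∈ O x ↔ ∃ b, ρ b x = z := by intro x z; simp [hO]
  have hinvO : ∀ x b z, ρ b z ∈ O x ↔ z ∈ O x := by
    intro x b z
    rw [hmemO, hmemO]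
    constructor
    · rintro ⟨c, hc⟩
      refine ⟨b⁻¹ * c, ?_⟩
      rw [map_mul, Perm.mul_apply, hc]; simp
    · rintro ⟨c, hc⟩
      exact ⟨b * c, by rw [map_mul, Perm.mul_apply, hc]⟩
  have hneO : ∀ x, x ∈ O x := fun x => (hmemO x x).2 ⟨1, by simp⟩
  have h0O : ∀ x, x ≠ 0 → 0 ∉ O x := by
    intro x hx h
    obtain ⟨b, hb⟩ := (hmemO x 0).1 h
    exact rho_ne_zero h0 b hx hb
  have hdisj : Disjoint (O x) (O y) := by
    rw [Finset.disjoint_left]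
    intro z hz hz'
    obtain ⟨b, hb⟩ := (hmemO x z).1 hz
    obtain ⟨c, hc⟩ := (hmemO y z).1 hz'
    refine hxy (c⁻¹ * b) ?_
    rw [map_mul, Perm.mul_apply, hb, ← hc]; simp
  have hle : (O x).card + (O y).card ≤ m - 1 := by
    rw [← Finset.card_union_of_disjoint hdisj]
    have h1 : O x ∪ O y ⊆ Finset.univ.erase 0 := by
      intro z hz
      rw [Finset.mem_erase]
      refine ⟨?_, Finset.mem_univ _⟩
      rintro rfl
      rcases Finset.mem_union.1 hz with h | h
      · exact h0O x hx h
      · exact h0O y hy h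
    have h2 := Finset.card_le_card h1
    rwa [Finset.card_erase_of_mem (Finset.mem_univ _), Finset.card_univ, ZMod.card] at h2
  obtain ⟨S, hS, hS0, hSn, hsm⟩ : ∃ S : Finset (ZMod m), (∀ b z, ρ b z ∈ S ↔ z ∈ S) ∧ 0 ∉ S ∧
      S.Nonempty ∧ 2 * S.card ≤ m - 1 := by
    rcases le_total (O x).card (O y).card with h | h
    · exact ⟨O x, hinvO x, h0O x hx, ⟨x, hneO x⟩, by omega⟩
    · exact ⟨O y, hinvO y, h0O y hy, ⟨y, hneO y⟩, by omega⟩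
  by_cases hp : m.Prime
  · have : Fact m.Prime := ⟨hp⟩
    have hlin : ∀ b, ∃ α, ∀ x, ρ b x = α * x := by
      intro b
      refine burnside_linear S hS0 hSn hsm (ρ b) (h0 b) ?_
      intro x
      exact ⟨ρ (τ x b), fun u => hS _ u, fun u => hτ b x u⟩
    obtain ⟨a, b, hab⟩ := A6_noncomm
    apply hab
    apply hinj
    obtain ⟨α, hα⟩ := hlin a
    obtain ⟨β, hβ⟩ := hlin b
    ext z
    rw [map_mul, map_mul, Perm.mul_apply, Perm.mul_apply, hα, hβ, hβ, hα, mul_left_comm]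
  · obtain ⟨p, hp1, hp2⟩ := Nat.exists_prime_and_dvd (show m ≠ 1 by omega)
    refine schur_small h0 hτ hprim p hp1 (by rwa [ZMod.card]) ?_ S hS hS0 hSn (by rwa [ZMod.card])
    rw [ZMod.card]
    rintro rfl
    exact hp hp1

theorem prim_seven' {A : Type*} [AddCommGroup A] [Finite A] [IsAddCyclic A]
    {ρ : A6 →* Perm A} {τ : A → A6 → A6}
    (h0 : ∀ b, ρ b 0 = 0)
    (hτ : ∀ b x y, ρ b (x + y) = ρ b x + ρ (τ x b) y)
    (hinj : Function.Injective ρ)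
    (hprim : ∀ D : AddSubgroup A, (∀ b, ∀ x ∈ D, ρ b x ∈ D) → D = ⊥ ∨ D = ⊤) :
    Nat.card A = 7 := by
  have : NeZero (Nat.card A) := ⟨Nat.card_pos.ne'⟩
  let e : A ≃+ ZMod (Nat.card A) := (zmodAddCyclicAddEquiv inferInstance).symm
  let ρ' : A6 →* Perm (ZMod (Nat.card A)) := (e.toEquiv.permCongrHom.toMonoidHom).comp ρ
  have hρ' : ∀ b x, ρ' b x = e (ρ b (e.symm x)) := fun b x => rfl
  refine prim_seven (ρ := ρ') (τ := fun x b => τ (e.symm x) b) ?_ ?_ ?_ ?_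
  · intro b; rw [hρ', map_zero, h0, map_zero]
  · intro b x y; rw [hρ', hρ', hρ', map_add, hτ, map_add]
  · exact (e.toEquiv.permCongrHom.injective).comp hinj
  · intro D hD
    have := hprim (D.comap e.toAddMonoidHom) (by
      intro b x hx
      have h1 := hD b (e x) hx
      rw [hρ', AddEquiv.symm_apply_apply] at h1
      exact h1)
    rcases this with h | h
    · left
      rw [eq_bot_iff]
      intro x hx
      have : e.symm x ∈ D.comap e.toAddMonoidHom := by
        change e (e.symm x) ∈ D
        simpa using hx
      rw [h, AddSubgroup.mem_bot] at this
      simpa using this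
    · right
      rw [eq_top_iff]
      intro x _
      have : e.symm x ∈ D.comap e.toAddMonoidHom := by rw [h]; trivial
      have h2 : e (e.symm x) ∈ D := this
      simpa using h2

end Primitive


section Degree

/-- Orbit sizes of `A6`: trivial, or at least six and not seven. -/
theorem orbit_size {X : Type*} [Finite X] (ρ : A6 →* Perm X) (x : X) (hx : ∃ b, ρ b x ≠ x) :
    6 ≤ Nat.card {z // ∃ b, ρ b x = z} ∧ Nat.card {z // ∃ b, ρ b x = z} ≠ 7 := by
  letI : MulAction A6 X := MulAction.compHom X ρ
  have hsm : ∀ (b : A6) (z : X), b • z = ρ b z := fun _ _ => rfl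
  have e : Nat.card {z // ∃ b, ρ b x = z} = Nat.card (MulAction.orbit A6 x) := rfl
  rw [e]
  have : Fintype (MulAction.orbit A6 x) := Fintype.ofFinite _
  have : Fintype (MulAction.stabilizer A6 x) := Fintype.ofFinite _
  rw [Nat.card_eq_fintype_card]
  have h1 := MulAction.card_orbit_mul_card_stabilizer_eq_card_group A6 x
  rw [A6_card] at h1
  constructor
  · classical
    have hinj : Function.Injective (MulAction.toPermHom A6 (MulAction.orbit A6 x)) := by
      rw [← MonoidHom.ker_eq_bot_iff]
      rcases A6_simple (MulAction.toPermHom A6 (MulAction.orbit A6 x)).ker inferInstance with h | h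
      · exact h
      · exfalso
        obtain ⟨b, hb⟩ := hx
        apply hb
        have h2 : b ∈ (MulAction.toPermHom A6 (MulAction.orbit A6 x)).ker := by rw [h]; trivial
        rw [MonoidHom.mem_ker] at h2
        have h3 := congrArg (fun g : Perm (MulAction.orbit A6 x) =>
          ((g ⟨x, MulAction.mem_orbit_self x⟩ : MulAction.orbit A6 x) : X)) h2
        exact h3
    have h2 := Fintype.card_le_of_injective _ hinj
    rw [A6_card, Fintype.card_perm] at h2
    by_contra hlt
    have h3 := Nat.factorial_le (show Fintype.card (MulAction.orbit A6 x) ≤ 5 by omega)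
    have : Nat.factorial 5 = 120 := rfl
    omega
  · intro h7
    rw [h7] at h1
    omega

theorem degree_seven {n : ℕ} [NeZero n] {ρ : A6 →* Perm (ZMod n)} {τ : ZMod n → A6 → A6}
    (h0 : ∀ b, ρ b 0 = 0)
    (hτ : ∀ b x y, ρ b (x + y) = ρ b x + ρ (τ x b) y)
    (hinj : Function.Injective ρ)
    (hf : ∀ d : ZMod n, (∀ b, τ d b = b) → d = 0) : n = 7 := by
  have hn := m_ge hinj
  have hfix : ∀ d : ZMod n, (∀ b, ρ b d = d) → d = 0 := by
    intro d hd
    apply hf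
    intro b
    apply hinj
    ext y
    have h1 := hτ b d y
    rw [add_comm d y, hτ b y d, hd, hd, add_comm] at h1
    rw [add_left_cancel h1]
  have : Fact (1 < n) := ⟨by omega⟩
  -- minimal invariant subgroup
  have : Finite (AddSubgroup (ZMod n)) := inferInstance
  obtain ⟨D, ⟨hD0, hDi⟩, hmin⟩ := (wellFounded_lt : WellFounded
    ((· < ·) : AddSubgroup (ZMod n) → AddSubgroup (ZMod n) → Prop)).has_min
    {D | D ≠ ⊥ ∧ ∀ b, ∀ x ∈ D, ρ b x ∈ D}
    ⟨⊤, (by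
      intro h
      have : (1 : ZMod n) ∈ (⊤ : AddSubgroup (ZMod n)) := trivial
      rw [h, AddSubgroup.mem_bot] at this
      exact one_ne_zero this), fun _ _ _ => trivial⟩
  have hDiff : ∀ b x, ρ b x ∈ D ↔ x ∈ D := by
    intro b x
    refine ⟨fun h => ?_, hDi b x⟩
    have := hDi b⁻¹ _ h
    rw [map_inv] at this
    simpa using this
  let ρD : A6 →* Perm D :=
    { toFun := fun b => (ρ b).subtypePerm (fun x => hDiff b x)
      map_one' := by ext x; simp
      map_mul' := by
        intro a b; apply Equiv.ext; intro x; apply Subtype.ext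
        change ρ (a * b) x = ρ a (ρ b x)
        rw [map_mul]; rfl }
  have hρD : ∀ b (x : D), ((ρD b x : D) : ZMod n) = ρ b x := fun _ _ => rfl
  have hinjD : Function.Injective ρD := by
    rw [← MonoidHom.ker_eq_bot_iff]
    rcases A6_simple ρD.ker inferInstance with h | h
    · exact h
    · exfalso
      apply hD0
      rw [eq_bot_iff]
      intro x hx
      rw [AddSubgroup.mem_bot]
      apply hfix
      intro b
      have h2 : b ∈ ρD.ker := by rw [h]; trivial
      rw [MonoidHom.mem_ker] at h2
      rw [← hρD b ⟨x, hx⟩, h2]; rfl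
  have hDcard : Nat.card D = 7 := by
    refine prim_seven' (ρ := ρD) (τ := fun x b => τ x b) ?_ ?_ hinjD ?_
    · intro b; apply Subtype.ext; exact h0 b
    · intro b x y; apply Subtype.ext; exact hτ b x y
    · intro E hE
      have hmemE : ∀ x : D, (x : ZMod n) ∈ E.map D.subtype ↔ x ∈ E := by
        intro x
        constructor
        · rintro ⟨y, hy, hxy⟩
          have : y = x := Subtype.ext hxy
          rwa [← this]
        · intro h; exact ⟨x, h, rfl⟩
      by_cases hE0 : E = ⊥
      · exact Or.inl hE0
      right
      have hle : E.map D.subtype ≤ D := by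
        rintro _ ⟨y, _, rfl⟩; exact y.2
      have hnlt := hmin (E.map D.subtype) ⟨by
          intro h
          apply hE0
          rw [eq_bot_iff]
          intro x hx
          have := (hmemE x).2 hx
          rw [h, AddSubgroup.mem_bot] at this
          rw [AddSubgroup.mem_bot]
          exact Subtype.ext this, by
          rintro b _ ⟨y, hy, rfl⟩
          exact ⟨ρD b y, hE b y hy, rfl⟩⟩
      have heq : E.map D.subtype = D := by
        by_contra hne
        exact hnlt (lt_of_le_of_ne hle hne)
      rw [eq_top_iff]
      intro x _
      rw [← hmemE, heq]; exact x.2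
  -- cosets are preserved
  let K : Subgroup A6 :=
    { carrier := {b | ∀ x, ρ b x - x ∈ D}
      one_mem' := by intro x; simp
      mul_mem' := by
        intro a b ha hb x
        have := D.add_mem (ha (ρ b x)) (hb x)
        simpa using this
      inv_mem' := by
        intro a ha x
        have := D.neg_mem (ha (ρ a⁻¹ x))
        simpa using this }
  have hKn : K.Normal := by
    refine ⟨fun b hb c x => ?_⟩
    have h1 : ρ (c * b * c⁻¹) x = ρ c (ρ c⁻¹ x + (ρ b (ρ c⁻¹ x) - ρ c⁻¹ x)) := by
      simp
    rw [h1, hτ]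
    have h2 : ρ c (ρ c⁻¹ x) = x := by simp
    rw [h2, add_sub_cancel_left]
    exact hDi _ _ (hb _)
  have hK : K = ⊤ := by
    rcases A6_simple K hKn with h | h
    · exfalso
      apply hD0
      rw [eq_bot_iff]
      intro d hd
      rw [AddSubgroup.mem_bot]
      apply hf
      intro b
      have hmem : τ d b * b⁻¹ ∈ K := by
        intro x
        have h2 : ρ b (ρ b⁻¹ x) = x := by simp
        have h1 := hτ b d (ρ b⁻¹ x)
        rw [add_comm d, hτ b (ρ b⁻¹ x) d, h2] at h1
        rw [map_mul, Perm.mul_apply]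
        have h3 : ρ (τ d b) (ρ b⁻¹ x) - x = ρ (τ (ρ b⁻¹ x) b) d - ρ b d := by
          linear_combination -h1
        rw [h3]
        exact D.sub_mem (hDi _ _ hd) (hDi _ _ hd)
      rw [h, Subgroup.mem_bot] at hmem
      exact mul_inv_eq_one.1 hmem
    · exact h
  have hcos : ∀ b x, ρ b x - x ∈ D := by
    intro b
    have : b ∈ K := by rw [hK]; trivial
    exact this
  -- everything is in D
  have hall : ∀ x, x ∈ D := by
    intro x
    by_cases hx : ∃ b, ρ b x ≠ x
    · have ho := orbit_size ρ x hx
      classical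
      let C : Finset (ZMod n) := Finset.univ.filter fun z => z - x ∈ D
      have hC : C.card = 7 := by
        rw [← hDcard, Nat.card_eq_fintype_card, ← Fintype.card_coe]
        refine Fintype.card_congr ⟨fun z => ⟨z.1 - x, (Finset.mem_filter.1 z.2).2⟩,
          fun d => ⟨d.1 + x, Finset.mem_filter.2 ⟨Finset.mem_univ _, by simp⟩⟩, ?_, ?_⟩
        · intro z; simp
        · intro z; simp
      let O : Finset (ZMod n) := Finset.univ.filter fun z => ∃ b, ρ b x = z
      have hO : O.card = Nat.card {z // ∃ b, ρ b x = z} := by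
        rw [Nat.card_eq_fintype_card, Fintype.card_subtype]
      have hOC : O ⊆ C := by
        intro z hz
        obtain ⟨b, rfl⟩ := (Finset.mem_filter.1 hz).2
        exact Finset.mem_filter.2 ⟨Finset.mem_univ _, hcos b x⟩
      have hle := Finset.card_le_card hOC
      have hd : (C \ O).card = 1 := by
        rw [Finset.card_sdiff_of_subset hOC]; omega
      obtain ⟨z, hz⟩ := Finset.card_eq_one.1 hd
      have hzC : z ∈ C \ O := by rw [hz]; simp
      have hzfix : ∀ b, ρ b z = z := by
        intro b
        have : ρ b z ∈ C \ O := by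
          rw [Finset.mem_sdiff] at hzC ⊢
          refine ⟨Finset.mem_filter.2 ⟨Finset.mem_univ _, ?_⟩, ?_⟩
          · have h1 := D.add_mem (hcos b z) (Finset.mem_filter.1 hzC.1).2
            simpa using h1
          · intro h
            apply hzC.2
            obtain ⟨c, hc⟩ := (Finset.mem_filter.1 h).2
            refine Finset.mem_filter.2 ⟨Finset.mem_univ _, b⁻¹ * c, ?_⟩
            rw [map_mul, Perm.mul_apply, hc]; simp
        rw [hz] at this
        simpa using this
      have hz0 := hfix z hzfix
      have h1 := (Finset.mem_filter.1 (Finset.mem_sdiff.1 hzC).1).2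
      rw [hz0, zero_sub] at h1
      simpa using h1
    · push Not at hx
      rw [hfix x hx]
      exact D.zero_mem
  have hDtop : D = ⊤ := by rw [eq_top_iff]; intro x _; exact hall x
  rw [hDtop] at hDcard
  rwa [AddSubgroup.card_top, Nat.card_zmod] at hDcard

end Degree


section Classification

/-- The relation between a skew morphism and its power action on `ZMod 7`. -/
def RelR (φ : A6 → A6) (ρ : A6 →* Perm (ZMod 7)) : Prop :=
  ∀ a y, ρ a⁻¹ (1 + y) = ρ a⁻¹ 1 + ρ (φ a)⁻¹ y

/-- Faithful actions fixing zero. -/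
def YGood (ρ : A6 →* Perm (ZMod 7)) : Prop :=
  Function.Injective ρ ∧ ∀ b, ρ b 0 = 0

theorem classify (φ : A6 → A6) (hφ : IsProperSkewMorphism φ) :
    ∃ ρ : A6 →* Perm (ZMod 7), YGood ρ ∧ RelR φ ρ := by
  obtain ⟨⟨hbij, h1, π, hπ⟩, hprop⟩ := hφ
  let Φ : Perm A6 := Equiv.ofBijective φ hbij
  have hΦ : ∀ a, Φ a = φ a := fun _ => rfl
  have hit : ∀ (k : ℕ) a, φ^[k] a = (Φ ^ k) a := by
    intro k a
    rw [← Perm.iterate_eq_pow]; rfl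
  obtain ⟨n, hn⟩ : ∃ n, n = orderOf Φ := ⟨_, rfl⟩
  have hn0 : NeZero n := ⟨by rw [hn]; exact (orderOf_pos Φ).ne'⟩
  let P : ZMod n → Perm A6 := fun x => Φ ^ x.val
  have hPn : ∀ k : ℕ, P (k : ZMod n) = Φ ^ k := by
    intro k
    change Φ ^ ((k : ZMod n).val) = _
    rw [ZMod.val_natCast, hn, pow_mod_orderOf]
  have hP0 : P 0 = 1 := by simpa using hPn 0
  have hP1 : P 1 = Φ := by simpa using hPn 1
  have hPadd : ∀ x y, P (x + y) = P y * P x := by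
    intro x y
    have := hPn (y.val + x.val)
    rw [pow_add] at this
    rw [add_comm, ← ZMod.natCast_zmod_val x, ← ZMod.natCast_zmod_val y, ← Nat.cast_add, this,
      hPn, hPn]
  have hPinj : Function.Injective P := by
    intro x y hxy
    have h2 : Φ ^ x.val = Φ ^ y.val := hxy
    rw [pow_inj_mod, ← hn, Nat.mod_eq_of_lt (ZMod.val_lt x), Nat.mod_eq_of_lt (ZMod.val_lt y)] at h2
    exact ZMod.val_injective n h2
  have hP1' : ∀ x, P x 1 = 1 := by
    intro x
    change (Φ ^ x.val) 1 = 1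
    rw [← hit]
    exact Function.iterate_fixed h1 _
  have hexN : ∀ (a : A6) (k : ℕ), ∃ y : ℕ, ∀ b, (Φ ^ k) (a * b) = (Φ ^ k) a * (Φ ^ y) b := by
    intro a k
    induction k with
    | zero => exact ⟨0, fun b => by simp⟩
    | succ k ih =>
      obtain ⟨y, hy⟩ := ih
      refine ⟨π ((Φ ^ k) a) + y, fun b => ?_⟩
      rw [pow_succ', Perm.mul_apply, hy, hΦ, hπ, hit, Perm.mul_apply, hΦ, pow_add, Perm.mul_apply]
  have hex : ∀ (a : A6) (x : ZMod n), ∃ y : ZMod n, ∀ b, P x (a * b) = P x a * P y b := by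
    intro a x
    obtain ⟨y, hy⟩ := hexN a x.val
    refine ⟨y, fun b => ?_⟩
    rw [hPn]; exact hy b
  choose σ hσ using hex
  have huniq : ∀ a x y, (∀ b, P x (a * b) = P x a * P y b) → σ a x = y := by
    intro a x y hy
    apply hPinj
    apply Equiv.ext
    intro b
    have := (hσ a x b).symm.trans (hy b)
    exact mul_left_cancel this
  have hσmul : ∀ a b x, σ (a * b) x = σ b (σ a x) := by
    intro a b x
    apply huniq
    intro c
    rw [mul_assoc, hσ a x (b * c), hσ b (σ a x) c, hσ a x b, mul_assoc]
  have hσadd : ∀ a x y, σ a (x + y) = σ a x + σ (P x a) y := by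
    intro a x y
    apply huniq
    intro b
    rw [hPadd, Perm.mul_apply, hσ a x b, hσ (P x a) y, hPadd, Perm.mul_apply, Perm.mul_apply]
  have hσ1 : ∀ x, σ 1 x = x := by
    intro x
    apply huniq
    intro b
    rw [one_mul, hP1', one_mul]
  have hσ0 : ∀ a, σ a 0 = 0 := by
    intro a
    apply huniq
    intro b
    rw [hP0]; rfl
  let ρ : A6 →* Perm (ZMod n) :=
    { toFun := fun a =>
        { toFun := σ a⁻¹
          invFun := σ a
          left_inv := fun x => by rw [← hσmul, inv_mul_cancel, hσ1]
          right_inv := fun x => by rw [← hσmul, mul_inv_cancel, hσ1] }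
      map_one' := by
        apply Equiv.ext; intro x
        change σ 1⁻¹ x = x
        rw [inv_one, hσ1]
      map_mul' := by
        intro a b
        apply Equiv.ext; intro x
        change σ (a * b)⁻¹ x = σ a⁻¹ (σ b⁻¹ x)
        rw [mul_inv_rev, hσmul] }
  have hρ : ∀ a x, ρ a x = σ a⁻¹ x := fun _ _ => rfl
  have h0 : ∀ b, ρ b 0 = 0 := fun b => hσ0 _
  have hτ : ∀ b x y, ρ b (x + y) = ρ b x + ρ ((P x b⁻¹)⁻¹) y := by
    intro b x y
    rw [hρ, hρ, hρ, inv_inv, hσadd]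
  have hinj : Function.Injective ρ := by
    rw [← MonoidHom.ker_eq_bot_iff]
    rcases A6_simple ρ.ker inferInstance with h | h
    · exact h
    · exfalso
      apply hprop
      intro a b
      have h2 : a⁻¹ ∈ ρ.ker := by rw [h]; trivial
      rw [MonoidHom.mem_ker] at h2
      have h3 : σ a 1 = 1 := by
        have := congrArg (fun g : Perm (ZMod n) => g 1) h2
        simp only [hρ, inv_inv] at this
        exact this
      have h4 := hσ a 1 b
      rw [h3, hP1] at h4
      exact h4
  have hn7 : n = 7 := by
    refine degree_seven (τ := fun x b => (P x b⁻¹)⁻¹) h0 hτ hinj ?_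
    intro d hd
    apply hPinj
    rw [hP0]
    apply Equiv.ext
    intro b
    have := hd b⁻¹
    rw [inv_inv] at this
    exact inv_injective this
  subst hn7
  refine ⟨ρ, ⟨hinj, h0⟩, ?_⟩
  intro a y
  rw [hτ, inv_inv, hP1, hΦ]

end Classification


section Counting

variable {φ φ' : A6 → A6} {ρ ρ' : A6 →* Perm (ZMod 7)}

theorem RelR.unique (hρ : YGood ρ) (h : RelR φ ρ) (h' : RelR φ' ρ) : φ = φ' := by
  funext a
  have : (φ a)⁻¹ = (φ' a)⁻¹ := by
    apply hρ.1
    ext y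
    have := (h a y).symm.trans (h' a y)
    rw [add_left_cancel this]
  exact inv_injective this

theorem RelR.iter (h0 : ∀ b, ρ b 0 = 0) (h : RelR φ ρ) (k : ℕ) (a : A6) (y : ZMod 7) :
    ρ a⁻¹ (k + y) = ρ a⁻¹ k + ρ (φ^[k] a)⁻¹ y := by
  induction k generalizing a y with
  | zero => rw [Nat.cast_zero, zero_add, h0, zero_add]; rfl
  | succ k ih =>
    have e : ((k + 1 : ℕ) : ZMod 7) = 1 + (k : ZMod 7) := by push_cast; ring
    rw [e, add_assoc, h a, h a, ih, Function.iterate_succ_apply, add_assoc]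

theorem RelR.iter_seven (hρ : YGood ρ) (h : RelR φ ρ) (a : A6) : φ^[7] a = a := by
  apply inv_injective
  apply hρ.1
  ext y
  have := h.iter hρ.2 7 a y
  have e : ((7 : ℕ) : ZMod 7) = 0 := by decide
  rw [e, zero_add, hρ.2, zero_add] at this
  rw [this]

theorem RelR.ne_id (hρ : YGood ρ) (h : RelR φ ρ) : ∃ a, φ a ≠ a := by
  by_contra hcon
  push Not at hcon
  have hlin : ∀ (a : A6) (y : ZMod 7), ρ a⁻¹ y = y * ρ a⁻¹ 1 := by
    intro a y
    have : ∀ k : ℕ, ρ a⁻¹ (k : ZMod 7) = k * ρ a⁻¹ 1 := by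
      intro k
      induction k with
      | zero => rw [Nat.cast_zero, hρ.2, zero_mul]
      | succ k ih =>
        have e : ((k + 1 : ℕ) : ZMod 7) = 1 + (k : ZMod 7) := by push_cast; ring
        rw [e, h a, hcon, ih]; ring
    have h2 := this y.val
    rwa [ZMod.natCast_zmod_val] at h2
  have hlin' : ∀ (a : A6) (y : ZMod 7), ρ a y = y * ρ a 1 := by
    intro a y
    have := hlin a⁻¹ y
    rwa [inv_inv] at this
  obtain ⟨a, b, hab⟩ := A6_noncomm
  apply hab
  apply hρ.1
  ext z
  rw [map_mul, map_mul, Perm.mul_apply, Perm.mul_apply, hlin' a (ρ b z), hlin' b z,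
    hlin' b (ρ a z), hlin' a z, mul_right_comm]

theorem RelR.skew (hρ : YGood ρ) (h : RelR φ ρ) (a b : A6) :
    φ (a * b) = φ a * φ^[(ρ a⁻¹ 1).val] b := by
  apply inv_injective
  apply hρ.1
  ext y
  have h1 := h (a * b) y
  have h2 := h.iter hρ.2 (ρ a⁻¹ 1).val b (ρ (φ a)⁻¹ y)
  rw [ZMod.natCast_zmod_val] at h2
  rw [mul_inv_rev, map_mul, Perm.mul_apply, Perm.mul_apply, h a, h2] at h1
  have h3 := add_left_cancel h1
  rw [← h3, mul_inv_rev, map_mul, Perm.mul_apply]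

theorem RelR.bij (hρ : YGood ρ) (h : RelR φ ρ) : Function.Bijective φ := by
  have h7 := h.iter_seven hρ
  constructor
  · intro a b hab
    have e : φ^[6] (φ a) = φ^[6] (φ b) := by rw [hab]
    rwa [← Function.iterate_succ_apply, ← Function.iterate_succ_apply, h7, h7] at e
  · intro a
    exact ⟨φ^[6] a, (Function.iterate_succ_apply' φ 6 a).symm.trans (h7 a)⟩

theorem RelR.pow_eq (hρ : YGood ρ) (h : RelR φ ρ) {x y : ZMod 7}
    (hxy : ∀ a, φ^[x.val] a = φ^[y.val] a) : x = y := by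
  let Φ : Perm A6 := Equiv.ofBijective φ (h.bij hρ)
  have hit : ∀ (k : ℕ) a, φ^[k] a = (Φ ^ k) a := by
    intro k a
    rw [← Perm.iterate_eq_pow]; rfl
  have : Fact (Nat.Prime 7) := ⟨by norm_num⟩
  have hord : orderOf Φ = 7 := by
    apply orderOf_eq_prime
    · ext1 a; rw [← hit, h.iter_seven hρ]; rfl
    · intro h1
      obtain ⟨a, ha⟩ := h.ne_id hρ
      apply ha
      have := congrArg (fun g : Perm A6 => g a) h1
      exact this
  have h2 : Φ ^ x.val = Φ ^ y.val := by
    ext1 a; rw [← hit, ← hit, hxy]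
  rw [pow_inj_mod, hord, Nat.mod_eq_of_lt (ZMod.val_lt x), Nat.mod_eq_of_lt (ZMod.val_lt y)] at h2
  exact ZMod.val_injective 7 h2

theorem RelR.ext_of_one (hρ : ∀ b, ρ b 0 = 0) (hρ' : ∀ b, ρ' b 0 = 0) (h : RelR φ ρ) (h' : RelR φ ρ')
    (h1 : ∀ a, ρ a⁻¹ 1 = ρ' a⁻¹ 1) : ρ = ρ' := by
  have : ∀ (k : ℕ) (a : A6), ρ a⁻¹ (k : ZMod 7) = ρ' a⁻¹ (k : ZMod 7) := by
    intro k
    induction k with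
    | zero => intro a; simp only [Nat.cast_zero, hρ, hρ']
    | succ k ih =>
      intro a
      have e : ((k + 1 : ℕ) : ZMod 7) = 1 + (k : ZMod 7) := by push_cast; ring
      rw [e, h a, h' a, ih, h1]
  ext1 a
  ext1 y
  have h2 := this y.val a⁻¹
  rwa [ZMod.natCast_zmod_val, inv_inv] at h2

theorem RelR.rho_unique (hρ : YGood ρ) (hρ' : YGood ρ') (h : RelR φ ρ) (h' : RelR φ ρ') :
    ρ = ρ' := by
  refine h.ext_of_one hρ.2 hρ'.2 h' ?_
  intro a
  apply h.pow_eq hρ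
  intro b
  exact mul_left_cancel ((h.skew hρ a b).symm.trans (h'.skew hρ' a b))

theorem RelR.proper (hρ : YGood ρ) (h : RelR φ ρ) : IsProperSkewMorphism φ := by
  refine ⟨⟨h.bij hρ, ?_, fun a => (ρ a⁻¹ 1).val, h.skew hρ⟩, ?_⟩
  · have := h.skew hρ 1 1
    have e1 : ρ (1 : A6)⁻¹ 1 = 1 := by simp
    rw [one_mul, e1, show (1 : ZMod 7).val = 1 from rfl, Function.iterate_one] at this
    exact left_eq_mul.1 this
  · intro hhom
    have h1 : ∀ a, ρ a⁻¹ 1 = 1 := by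
      intro a
      apply h.pow_eq hρ
      intro b
      have := (h.skew hρ a b).symm.trans (hhom a b)
      rw [mul_left_cancel this, show (1 : ZMod 7).val = 1 from rfl, Function.iterate_one]
    have h2 : ρ = 1 := by
      refine h.ext_of_one (ρ' := 1) hρ.2 (fun _ => rfl) ?_ h1
      intro a y; rfl
    obtain ⟨a, b, hab⟩ := A6_noncomm
    apply hab
    apply hρ.1
    rw [h2]; rfl

/-- Extend a permutation of six points to `ZMod 7`, fixing zero. -/
def ext6 : Perm (Fin 6) →* Perm (ZMod 7) where
  toFun e := (Perm.decomposeFin.symm ((0 : Fin 7), e) : Perm (Fin 7))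
  map_one' := by
    apply Equiv.ext
    intro (x : Fin 7)
    refine Fin.cases ?_ (fun i => ?_) x
    · exact Perm.decomposeFin_symm_apply_zero _ _
    · exact (Perm.decomposeFin_symm_apply_succ _ _ _).trans (by simp; rfl)
  map_mul' := by
    intro e f
    apply Equiv.ext
    intro (x : Fin 7)
    change Perm.decomposeFin.symm ((0 : Fin 7), e * f) x =
      Perm.decomposeFin.symm ((0 : Fin 7), e) (Perm.decomposeFin.symm ((0 : Fin 7), f) x)
    refine Fin.cases ?_ (fun i => ?_) x
    · simp
    · simp

theorem ext6_zero (e : Perm (Fin 6)) : ext6 e 0 = 0 :=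
  Perm.decomposeFin_symm_apply_zero (0 : Fin 7) e

theorem ext6_inj : Function.Injective ext6 := by
  intro e f h
  have h2 : Perm.decomposeFin.symm ((0 : Fin 7), e) = Perm.decomposeFin.symm ((0 : Fin 7), f) := h
  have h3 := Perm.decomposeFin.symm.injective h2
  exact congrArg Prod.snd h3

theorem ext6_surj (g : Perm (ZMod 7)) (hg : g 0 = 0) : ∃ e, ext6 e = g := by
  obtain ⟨⟨p, e⟩, h⟩ := Perm.decomposeFin.symm.surjective (g : Perm (Fin 7))
  refine ⟨e, ?_⟩
  have h2 : p = (0 : Fin 7) := by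
    have := Perm.decomposeFin_symm_apply_zero p e
    rw [h] at this
    exact this.symm.trans hg
  subst h2
  exact h

theorem ext6_sign (e : Perm (Fin 6)) : Perm.sign (ext6 e) = Perm.sign e := by
  have := Perm.decomposeFin.symm_sign (0 : Fin 7) e
  simp only [if_true, one_mul] at this
  exact this

theorem hom_surj (η : A6 →* Perm (Fin 6)) (hη : Function.Injective η) (e : Perm (Fin 6))
    (he : Perm.sign e = 1) : ∃ b, η b = e := by
  have hs : ∀ b, Perm.sign (η b) = 1 := fun b => A6_hom_comm (Perm.sign.comp η) b
  let f : A6 → A6 := fun b => ⟨η b, hs b⟩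
  have hf : Function.Injective f := fun a b hab => hη (congrArg Subtype.val hab)
  obtain ⟨b, hb⟩ := (Finite.injective_iff_surjective.1 hf) ⟨e, he⟩
  exact ⟨b, congrArg Subtype.val hb⟩

theorem good_of_hom (η : A6 →* Perm (Fin 6)) (hη : Function.Injective η) :
    YGood (ext6.comp η) :=
  ⟨ext6_inj.comp hη, fun b => ext6_zero _⟩

theorem hom_of_good (hρ : YGood ρ) : ∃ η : A6 →* Perm (Fin 6), Function.Injective η ∧
    ext6.comp η = ρ := by
  have hch : ∀ b, ∃ e, ext6 e = ρ b := fun b => ext6_surj _ (hρ.2 b)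
  choose e he using hch
  let η : A6 →* Perm (Fin 6) :=
    { toFun := e
      map_one' := ext6_inj (by rw [he, map_one, map_one])
      map_mul' := fun a b => ext6_inj (by rw [he, map_mul, map_mul, he, he]) }
  have hη : ext6.comp η = ρ := by ext1 b; exact he b
  refine ⟨η, ?_, hη⟩
  intro a b hab
  apply hρ.1
  rw [← hη]
  exact congrArg ext6 hab

theorem rel_exists (hρ : YGood ρ) : ∃ φ, RelR φ ρ := by
  obtain ⟨η, hη, rfl⟩ := hom_of_good hρ
  have key : ∀ a : A6, ∃ c : A6, ∀ y, ext6.comp η a⁻¹ (1 + y) = ext6.comp η a⁻¹ 1 + ext6.comp η c⁻¹ y := by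
    intro a
    let g : Perm (ZMod 7) := (Equiv.addLeft (ext6.comp η a⁻¹ 1))⁻¹ * (ext6.comp η a⁻¹) * Equiv.addLeft 1
    have hsa : ∀ x : ZMod 7, Perm.sign (Equiv.addLeft x) = 1 := by decide +kernel
    have hs : Perm.sign g = 1 := by
      change Perm.sign ((Equiv.addLeft (ext6.comp η a⁻¹ 1))⁻¹ * (ext6.comp η a⁻¹) * Equiv.addLeft 1) = 1
      rw [map_mul, map_mul, map_inv, hsa, hsa, inv_one, one_mul, mul_one]
      exact A6_hom_comm (Perm.sign.comp (ext6.comp η)) _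
    have hg : ∀ y, g y = -(ext6.comp η a⁻¹ 1) + ext6.comp η a⁻¹ (1 + y) := fun y => rfl
    have hg0 : g 0 = 0 := by rw [hg, add_zero, neg_add_cancel]
    obtain ⟨e, he⟩ := ext6_surj g hg0
    obtain ⟨b, hb⟩ := hom_surj η hη e (by rw [← ext6_sign, he, hs])
    refine ⟨b⁻¹, fun y => ?_⟩
    have : ext6.comp η b⁻¹⁻¹ y = g y := by
      rw [inv_inv, MonoidHom.comp_apply, hb, he]
    rw [this, hg, add_neg_cancel_left]
  choose φ hφ using key
  exact ⟨φ, hφ⟩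

theorem card_proper :
    Nat.card {φ : A6 → A6 // IsProperSkewMorphism φ} =
      Nat.card {η : A6 →* Perm (Fin 6) // Function.Injective η} := by
  have key : ∀ η : {η : A6 →* Perm (Fin 6) // Function.Injective η},
      ∃ φ, RelR φ (ext6.comp η.1) := fun η => rel_exists (good_of_hom η.1 η.2)
  choose F hF using key
  symm
  refine Nat.card_congr (Equiv.ofBijective
    (fun η => ⟨F η, (hF η).proper (good_of_hom η.1 η.2)⟩) ⟨?_, ?_⟩)
  · intro η η' h
    have h2 : F η = F η' := congrArg Subtype.val h
    have h3 := (hF η).rho_unique (good_of_hom η.1 η.2) (good_of_hom η'.1 η'.2) (h2 ▸ hF η')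
    apply Subtype.ext
    ext1 b
    exact ext6_inj (congrArg (fun f : A6 →* Perm (ZMod 7) => f b) h3)
  · rintro ⟨φ, hφ⟩
    obtain ⟨ρ, hρ, hR⟩ := classify φ hφ
    obtain ⟨η, hη, rfl⟩ := hom_of_good hρ
    refine ⟨⟨η, hη⟩, Subtype.ext ?_⟩
    exact (hF ⟨η, hη⟩).unique hρ hR

end Counting


section Automorphisms

/-- A five-cycle. -/
def px : Perm (Fin 6) := ⟨![1, 2, 3, 4, 0, 5], ![4, 0, 1, 2, 3, 5], by decide, by decide⟩

/-- A three-cycle. -/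
def py : Perm (Fin 6) := ⟨![1, 5, 2, 3, 4, 0], ![5, 0, 2, 3, 4, 1], by decide, by decide⟩

/-- The image of `py` under the outer automorphism. -/
def pz : Perm (Fin 6) := ⟨![2, 3, 5, 4, 1, 0], ![5, 4, 0, 1, 3, 2], by decide, by decide⟩

/-- Words in `px` (true) and `py` (false). -/
def pword (l : List Bool) : Perm (Fin 6) := (l.map fun b => if b then px else py).prod

/-- Coset representatives, level five. -/
def wordsA : List (List Bool) :=
  [[], [false], [true, false], [true, true, false], [true, true, true, false],
    [true, true, true, true, false]]

/-- Coset representatives, level four. -/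
def wordsB : List (List Bool) :=
  [[], [true], [true, true], [true, true, true], [true, true, true, true]]

/-- Coset representatives, level three. -/
def wordsC : List (List Bool) :=
  [[], [false, true, false, true, true, false, true, false],
    [true, false, true, false, true, true, true], [true, true, true, false, true, false]]

/-- Coset representatives, level two. -/
def wordsD : List (List Bool) :=
  [[], [false, true, false, true, true, true, true], [true, true, false, true, false, true]]

theorem chain_words : ∀ g : Perm (Fin 6), Perm.sign g = 1 →
    ∃ a ∈ wordsA, (pword a)⁻¹ (g 5) = 5 ∧ ∃ b ∈ wordsB, (pword b)⁻¹ ((pword a)⁻¹ (g 4)) = 4 ∧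
    ∃ c ∈ wordsC, (pword c)⁻¹ ((pword b)⁻¹ ((pword a)⁻¹ (g 3))) = 3 ∧
    ∃ d ∈ wordsD, g = pword a * pword b * pword c * pword d := by
  decide +kernel

theorem px_sign : Perm.sign px = 1 := by decide +kernel

theorem py_sign : Perm.sign py = 1 := by decide +kernel

/-- The five-cycle in `A6`. -/
def aX : A6 := ⟨px, px_sign⟩

/-- The three-cycle in `A6`. -/
def aY : A6 := ⟨py, py_sign⟩

theorem A6_gen (K : Subgroup A6) (hx : aX ∈ K) (hy : aY ∈ K) (g : A6) : g ∈ K := by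
  have hw : ∀ l, pword l ∈ K.map (alternatingGroup (Fin 6)).subtype := by
    intro l
    refine Subgroup.list_prod_mem _ ?_
    intro z hz
    obtain ⟨b, -, rfl⟩ := List.mem_map.1 hz
    cases b
    · exact ⟨aY, hy, rfl⟩
    · exact ⟨aX, hx, rfl⟩
  obtain ⟨a, -, -, b, -, -, c, -, -, d, -, h⟩ := chain_words g g.2
  have : (g : Perm (Fin 6)) ∈ K.map (alternatingGroup (Fin 6)).subtype := by
    rw [h]
    exact mul_mem (mul_mem (mul_mem (hw a) (hw b)) (hw c)) (hw d)
  obtain ⟨g', hg', e⟩ := this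
  have : g' = g := Subtype.ext e
  rwa [← this]

theorem hom_ext_gen {η η' : A6 →* Perm (Fin 6)} (hx : η aX = η' aX) (hy : η aY = η' aY) :
    η = η' := by
  ext1 g
  exact A6_gen (η.eqLocus η') hx hy g

theorem candidates : ∀ z : Perm (Fin 6), z ^ 3 = 1 → z ≠ 1 → (px * z) ^ 4 = 1 →
    (px * z) ^ 2 ≠ 1 → (px * px * z) ^ 4 = 1 → (px * px * z) ^ 2 ≠ 1 →
    ∃ i : Fin 5, z = px ^ i.val * py * (px ^ i.val)⁻¹ ∨ z = px ^ i.val * pz * (px ^ i.val)⁻¹ := by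
  decide +kernel

/-- One synthematic total. -/
def total0 : Finset (Perm (Fin 6)) :=
  {swap 0 5 * swap 1 2 * swap 3 4, swap 0 2 * swap 1 4 * swap 3 5, swap 0 3 * swap 1 5 * swap 2 4,
    swap 0 1 * swap 2 3 * swap 4 5, swap 0 4 * swap 1 3 * swap 2 5}

/-- The total invariant under `px`. -/
def total5 : Finset (Perm (Fin 6)) :=
  {swap 0 5 * swap 1 4 * swap 2 3, swap 1 5 * swap 0 2 * swap 3 4, swap 2 5 * swap 1 3 * swap 0 4,
    swap 3 5 * swap 2 4 * swap 0 1, swap 4 5 * swap 0 3 * swap 1 2}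

/-- Conjugation action on finite sets of permutations. -/
def cj (g : Perm (Fin 6)) (T : Finset (Perm (Fin 6))) : Finset (Perm (Fin 6)) :=
  T.image fun t => g * t * g⁻¹

/-- The six totals. -/
def totals (i : Fin 6) : Finset (Perm (Fin 6)) :=
  if i = 5 then total5 else cj (px ^ i.val) total0

theorem totals_inj : Function.Injective totals := by decide +kernel

theorem totals_x : ∀ i, cj px (totals i) = totals (px i) := by decide +kernel

theorem totals_y : ∀ i, cj py (totals i) = totals (pz i) := by decide +kernel

theorem cj_mul (g h : Perm (Fin 6)) (T : Finset (Perm (Fin 6))) : cj (g * h) T = cj g (cj h T) := by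
  unfold cj
  rw [Finset.image_image]
  congr 1

theorem cj_one (T : Finset (Perm (Fin 6))) : cj 1 T = T := by
  unfold cj
  simp

theorem exists_outer : ∃ θ : A6 →* Perm (Fin 6), θ aX = px ∧ θ aY = pz := by
  let K : Subgroup A6 :=
    { carrier := {g | ∃ w : Perm (Fin 6), ∀ i, cj g (totals i) = totals (w i)}
      one_mem' := ⟨1, fun i => cj_one _⟩
      mul_mem' := by
        rintro g h ⟨w, hw⟩ ⟨v, hv⟩
        exact ⟨w * v, fun i => by rw [Subgroup.coe_mul, cj_mul, hv, hw]; rfl⟩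
      inv_mem' := by
        rintro g ⟨w, hw⟩
        refine ⟨w⁻¹, fun i => ?_⟩
        have h1 := hw (w⁻¹ i)
        rw [show w (w⁻¹ i) = i by simp] at h1
        rw [← h1, ← cj_mul, Subgroup.coe_inv, inv_mul_cancel, cj_one] }
  have hK : ∀ g : A6, ∃ w : Perm (Fin 6), ∀ i, cj g (totals i) = totals (w i) :=
    fun g => A6_gen K ⟨px, totals_x⟩ ⟨pz, totals_y⟩ g
  choose w hw using hK
  have huniq : ∀ (g : A6) (v : Perm (Fin 6)), (∀ i, cj g (totals i) = totals (v i)) → w g = v := by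
    intro g v hv
    ext1 i
    exact totals_inj ((hw g i).symm.trans (hv i))
  refine ⟨{ toFun := w, map_one' := ?_, map_mul' := ?_ }, ?_, ?_⟩
  · exact huniq _ _ (fun i => cj_one _)
  · intro g h
    apply huniq
    intro i
    rw [Subgroup.coe_mul, cj_mul, hw, hw]; rfl
  · exact huniq _ _ totals_x
  · exact huniq _ _ totals_y

theorem px_conj (h : Perm (Fin 6)) (h5 : h ^ 5 = 1) (h1 : h ≠ 1) : ∃ g, g * h * g⁻¹ = px := by
  have : Fact (Nat.Prime 5) := ⟨Nat.prime_five⟩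
  have key : ∀ h : Perm (Fin 6), h ^ 5 = 1 → h ≠ 1 → h.cycleType = {5} := by
    intro h h5 h1
    have h4 := Perm.cycleType_of_pow_prime_eq_one (p := 5) h5
    have h6 := Perm.sum_cycleType h
    have h7 := Finset.card_le_univ h.support
    rw [← h6, h4, Fintype.card_fin] at h7
    simp at h7
    have h8 : Multiset.card h.cycleType ≠ 0 := by
      rw [Perm.card_cycleType_eq_zero.ne]; exact h1
    rw [h4, show Multiset.card h.cycleType = 1 by omega]
    rfl
  have hp5 : px ^ 5 = 1 := by decide +kernel
  have hp1 : px ≠ 1 := by decide +kernel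
  have hc := Perm.isConj_of_cycleType_eq ((key h h5 h1).trans (key px hp5 hp1).symm)
  exact isConj_iff.1 hc

theorem centralizer_triv : ∀ g : Perm (Fin 6), g * px = px * g → g * py = py * g → g = 1 := by
  decide +kernel

theorem hom_inj_of (η : A6 →* Perm (Fin 6)) (a : A6) (ha : η a ≠ 1) : Function.Injective η := by
  rw [← MonoidHom.ker_eq_bot_iff]
  rcases A6_simple η.ker inferInstance with h | h
  · exact h
  · exfalso; apply ha
    have : a ∈ η.ker := by rw [h]; trivial
    exact this

theorem card_inj_homs : Nat.card {η : A6 →* Perm (Fin 6) // Function.Injective η} = 1440 := by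
  obtain ⟨θ, hθx, hθy⟩ := exists_outer
  let ι : A6 →* Perm (Fin 6) := (alternatingGroup (Fin 6)).subtype
  have hιx : ι aX = px := rfl
  have hιy : ι aY = py := rfl
  have hpx1 : px ≠ 1 := by decide +kernel
  have hι : Function.Injective ι := Subtype.val_injective
  have hθ : Function.Injective θ := hom_inj_of θ aX (by rw [hθx]; exact hpx1)
  let base : Bool → (A6 →* Perm (Fin 6)) := fun b => if b then θ else ι
  have hbase : ∀ b, Function.Injective (base b) := by
    intro b; cases b
    · exact hι
    · exact hθ
  let F : Bool × Perm (Fin 6) → {η : A6 →* Perm (Fin 6) // Function.Injective η} := fun q =>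
    ⟨(MulAut.conj q.2).toMonoidHom.comp (base q.1),
      (MulAut.conj q.2).injective.comp (hbase q.1)⟩
  have hFa : ∀ q a, (F q).1 a = q.2 * base q.1 a * q.2⁻¹ := fun _ _ => rfl
  -- same base
  have hsame : ∀ b g g', (∀ a, g * base b a * g⁻¹ = g' * base b a * g'⁻¹) → g = g' := by
    intro b g g' h
    have hcomm : ∀ e, Perm.sign e = 1 → (g'⁻¹ * g) * e = e * (g'⁻¹ * g) := by
      intro e he
      obtain ⟨a, rfl⟩ := hom_surj (base b) (hbase b) e he
      have h1 := h a
      calc g'⁻¹ * g * base b a = g'⁻¹ * (g * base b a * g⁻¹) * g := by group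
        _ = base b a * (g'⁻¹ * g) := by rw [h1]; group
    have := centralizer_triv _ (hcomm _ px_sign) (hcomm _ py_sign)
    exact (inv_mul_eq_one.1 this).symm
  have hdiff : ∀ g g', ¬ (g * py * g⁻¹ = g' * pz * g'⁻¹) := by
    intro g g' h
    have h1 := congrArg (fun e : Perm (Fin 6) => e.cycleType) h
    simp only [Perm.cycleType_conj] at h1
    have h2 := congrArg Multiset.sum h1
    rw [Perm.sum_cycleType, Perm.sum_cycleType] at h2
    revert h2
    decide +kernel
  have hbij : Function.Bijective F := by
    constructor
    · rintro ⟨b, g⟩ ⟨b', g'⟩ h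
      have h1 : ∀ a, g * base b a * g⁻¹ = g' * base b' a * g'⁻¹ := by
        intro a
        rw [← hFa (b, g), ← hFa (b', g'), h]
      have hbb : b = b' := by
        cases b <;> cases b'
        · rfl
        · exfalso
          have h2 := h1 aY
          change g * ι aY * g⁻¹ = g' * θ aY * g'⁻¹ at h2
          rw [hιy, hθy] at h2
          exact hdiff _ _ h2
        · exfalso
          have h2 := h1 aY
          change g * θ aY * g⁻¹ = g' * ι aY * g'⁻¹ at h2
          rw [hιy, hθy] at h2
          exact hdiff _ _ h2.symm
        · rfl
      subst hbb
      rw [hsame b g g' h1]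
    · rintro ⟨η, hη⟩
      have hinj1 : ∀ a, a ≠ 1 → η a ≠ 1 := by
        intro a ha h; exact ha (hη (h.trans (map_one η).symm))
      have hX5 : aX ^ 5 = 1 := Subtype.ext (by change px ^ 5 = 1; decide +kernel)
      have hX1 : aX ≠ 1 := fun h => hpx1 (congrArg Subtype.val h)
      obtain ⟨g, hg⟩ := px_conj (η aX) (by rw [← map_pow, hX5, map_one]) (hinj1 _ hX1)
      let etaOne : A6 →* Perm (Fin 6) := (MulAut.conj g).toMonoidHom.comp η
      have heta_one_ : Function.Injective etaOne := (MulAut.conj g).injective.comp hη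
      have heta_one_a : ∀ a, etaOne a = g * η a * g⁻¹ := fun _ => rfl
      have heta_one_x : etaOne aX = px := hg
      have hne : ∀ a, a ≠ 1 → etaOne a ≠ 1 := by
        intro a ha h; exact ha (heta_one_ (h.trans (map_one etaOne).symm))
      have r1 : aY ^ 3 = 1 := Subtype.ext (by change py ^ 3 = 1; decide +kernel)
      have r2 : aY ≠ 1 := fun h => (by decide +kernel : py ≠ 1) (congrArg Subtype.val h)
      have r3 : (aX * aY) ^ 4 = 1 := Subtype.ext (by change (px * py) ^ 4 = 1; decide +kernel)
      have r4 : (aX * aY) ^ 2 ≠ 1 := fun h =>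
        (by decide +kernel : (px * py) ^ 2 ≠ 1) (congrArg Subtype.val h)
      have r5 : (aX * aX * aY) ^ 4 = 1 :=
        Subtype.ext (by change (px * px * py) ^ 4 = 1; decide +kernel)
      have r6 : (aX * aX * aY) ^ 2 ≠ 1 := fun h =>
        (by decide +kernel : (px * px * py) ^ 2 ≠ 1) (congrArg Subtype.val h)
      obtain ⟨i, hi⟩ := candidates (etaOne aY) (by rw [← map_pow, r1, map_one]) (hne _ r2)
        (by rw [← heta_one_x, ← map_mul, ← map_pow, r3, map_one])
        (by rw [← heta_one_x, ← map_mul, ← map_pow]; exact hne _ r4)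
        (by rw [← heta_one_x, ← map_mul, ← map_mul, ← map_pow, r5, map_one])
        (by rw [← heta_one_x, ← map_mul, ← map_mul, ← map_pow]; exact hne _ r6)
      have hfin : ∃ b, etaOne = (F (b, px ^ i.val)).1 := by
        rcases hi with hi | hi
        · refine ⟨false, hom_ext_gen ?_ ?_⟩
          · rw [heta_one_x, hFa]
            change px = px ^ i.val * px * (px ^ i.val)⁻¹
            group
          · rw [hi, hFa]; rfl
        · refine ⟨true, hom_ext_gen ?_ ?_⟩
          · rw [heta_one_x, hFa]
            change px = px ^ i.val * θ aX * (px ^ i.val)⁻¹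
            rw [hθx]
            group
          · rw [hi, hFa]
            change _ = px ^ i.val * θ aY * (px ^ i.val)⁻¹
            rw [hθy]
      obtain ⟨b, hb⟩ := hfin
      refine ⟨(b, g⁻¹ * px ^ i.val), Subtype.ext ?_⟩
      ext1 a
      rw [hFa]
      have h2 : g * η a * g⁻¹ = px ^ i.val * base b a * (px ^ i.val)⁻¹ := by
        rw [← heta_one_a, hb, hFa]
      change g⁻¹ * px ^ i.val * base b a * (g⁻¹ * px ^ i.val)⁻¹ = η a
      calc _ = g⁻¹ * (px ^ i.val * base b a * (px ^ i.val)⁻¹) * g := by group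
        _ = η a := by rw [← h2]; group
  rw [← Nat.card_congr (Equiv.ofBijective F hbij), Nat.card_eq_fintype_card, Fintype.card_prod,
    Fintype.card_perm, Fintype.card_bool, Fintype.card_fin]
  rfl

end Automorphisms

/-- `Alt(6)` has exactly `1440` proper skew morphisms. -/
theorem stmt_13 :
    Nat.card {φ : ↥(alternatingGroup (Fin 6)) → ↥(alternatingGroup (Fin 6)) //
      IsProperSkewMorphism φ} = 1440 := by
  exact card_proper.trans card_inj_homs
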